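/- arXiv:math/9907005 — 11 statements merged into one kernel-verified Lean document; each statement's English description precedes it below -/
import Mathlib

section
/- Let μ : (0,1] → (0,∞) be a nonincreasing function with ∫_0^1 μ(s) ds = ∞, and suppose that liminf_{t→0⁺} (log μ(t))/(log(1/t)) = 1. Define S(t) = ∫_t^1 μ(s) ds for t ∈ (0,1]. Then limsup_{t→0⁺} S(2t)/S(t) = 1. -/
open Filter MeasureTheory Set Topology

theorem liminf_order_one_of_nonintegrable_implies_limsup_ratio_one
    (μ S : ℝ → ℝ)
    (hpos : ∀ t ∈ Set.Ioc (0:ℝ) 1, 0 < μ t)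
    (hmono : ∀ s ∈ Set.Ioc (0:ℝ) 1, ∀ t ∈ Set.Ioc (0:ℝ) 1, s ≤ t → μ t ≤ μ s)
    (hint : ¬ IntegrableOn μ (Set.Ioc (0:ℝ) 1) volume)
    (hord : Filter.liminf (fun t => Real.log (μ t) / Real.log (1 / t)) (𝓝[>] (0:ℝ)) = 1)
    (hS : ∀ t ∈ Set.Ioc (0:ℝ) 1, S t = ∫ s in Set.Ioc t 1, μ s) :
    Filter.limsup (fun t => S (2 * t) / S t) (𝓝[>] (0:ℝ)) = 1 := by
  have hI : ∀ t, 0 < t → IntegrableOn μ (Set.Ioc t 1) volume := by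
    intro t ht
    have : AntitoneOn μ (Set.Icc t 1) := by
      intro x hx y hy hxy
      exact hmono x ⟨lt_of_lt_of_le ht hx.1, hx.2⟩ y ⟨lt_of_lt_of_le ht hy.1, hy.2⟩ hxy
    exact (this.integrableOn_isCompact isCompact_Icc).mono_set Set.Ioc_subset_Icc_self
  have hdiff : ∀ t u, 0 < t → t ≤ u → u ≤ 1 → S t = (∫ s in Set.Ioc t u, μ s) + S u := by
    intro t u ht htu hu
    rw [hS t ⟨ht, htu.trans hu⟩, hS u ⟨ht.trans_le htu, hu⟩,
      ← setIntegral_union (Set.Ioc_disjoint_Ioc_of_le le_rfl) measurableSet_Ioc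
        ((hI t ht).mono_set (Set.Ioc_subset_Ioc_right hu)) (hI u (ht.trans_le htu)),
      Set.Ioc_union_Ioc_eq_Ioc htu hu]
  have hnn : ∀ t u, 0 < t → u ≤ 1 → 0 ≤ ∫ s in Set.Ioc t u, μ s := by
    intro t u ht hu
    apply setIntegral_nonneg measurableSet_Ioc
    intro x hx
    exact (hpos x ⟨ht.trans hx.1, hx.2.trans hu⟩).le
  have hanti : ∀ t u, 0 < t → t ≤ u → u ≤ 1 → S u ≤ S t := by
    intro t u ht htu hu
    have := hdiff t u ht htu hu
    have := hnn t u ht hu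
    linarith
  have hSnn : ∀ t, 0 < t → t ≤ 1 → 0 ≤ S t := by
    intro t ht h1
    rw [hS t ⟨ht, h1⟩]
    exact hnn t 1 ht le_rfl
  have hSpos : ∀ t, 0 < t → t < 1 → 0 < S t := by
    intro t ht h1
    rw [hS t ⟨ht, h1.le⟩]
    have h2 : ∫ s in Set.Ioc t 1, μ 1 ≤ ∫ s in Set.Ioc t 1, μ s := by
      apply setIntegral_mono_on (by simp) (hI t ht) measurableSet_Ioc
      intro x hx
      exact hmono x ⟨ht.trans hx.1, hx.2⟩ 1 (by simp) hx.2
    have h3 : ∫ s in Set.Ioc t 1, μ 1 = (1 - t) * μ 1 := by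
      simp [h1.le]
    have := mul_pos (sub_pos.2 h1) (hpos 1 (by simp))
    linarith
  have hup : ∀ t, 0 < t → 2 * t ≤ 1 → S t ≤ t * μ t + S (2 * t) := by
    intro t ht h1
    rw [hdiff t (2 * t) ht (by linarith) h1]
    have h2 : ∫ s in Set.Ioc t (2 * t), μ s ≤ ∫ s in Set.Ioc t (2 * t), μ t := by
      apply setIntegral_mono_on ((hI t ht).mono_set (Set.Ioc_subset_Ioc_right h1)) (by simp)
        measurableSet_Ioc
      intro x hx
      exact hmono t ⟨ht, by linarith⟩ x ⟨ht.trans hx.1, hx.2.trans h1⟩ hx.1.le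
    have h3 : ∫ s in Set.Ioc t (2 * t), μ t = t * μ t := by
      have : t ≤ 2 * t := by linarith
      simp [this]
      left; ring
    linarith
  rw [Filter.limsup_eq]
  apply IsLeast.csInf_eq
  constructor
  · have : Set.Ioo (0:ℝ) (1/2) ∈ 𝓝[>] (0:ℝ) := Ioo_mem_nhdsGT (by norm_num)
    filter_upwards [this] with t ht
    have h1 := ht.1
    have h2 := ht.2
    exact div_le_one_of_le₀ (hanti t (2 * t) h1 (by linarith) (by linarith))
      (hSnn t h1 (by linarith))
  · intro a ha
    by_contra! hlt
    have ha' : ∀ᶠ t in 𝓝[>] (0:ℝ), S (2 * t) / S t ≤ a := ha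
    obtain ⟨c, hac, hc2, hc1⟩ : ∃ c : ℝ, a ≤ c ∧ 1 / 2 ≤ c ∧ c < 1 :=
      ⟨max a (1/2), le_max_left _ _, le_max_right _ _, max_lt hlt (by norm_num)⟩
    have hc0 : 0 < c := by linarith
    obtain ⟨b, hb0, hb⟩ := (mem_nhdsGT_iff_exists_Ioo_subset).1 ha'
    have hb0 : 0 < b := hb0
    obtain ⟨t0, ht0, ht0b, ht0h⟩ : ∃ t0 : ℝ, 0 < t0 ∧ t0 < b ∧ t0 < 1 / 2 := by
      refine ⟨min b (1/2) / 2, by positivity, ?_, ?_⟩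
      · have := min_le_left b (1/2); linarith
      · have := min_le_right b (1/2); linarith
    have hrat : ∀ t, 0 < t → t ≤ t0 → S (2 * t) ≤ c * S t := by
      intro t ht htt
      have h1 : S (2 * t) / S t ≤ a := hb ⟨ht, lt_of_le_of_lt htt ht0b⟩
      exact (div_le_iff₀ (hSpos t ht (by linarith))).1 (h1.trans hac)
    obtain ⟨δ, hδ, hδc⟩ : ∃ δ : ℝ, 0 < δ ∧ (2:ℝ) ^ (-δ) = c := by
      refine ⟨-Real.logb 2 c, ?_, ?_⟩
      · have := Real.logb_neg (b := 2) (by norm_num) hc0 hc1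
        linarith
      · rw [neg_neg]
        exact Real.rpow_logb (by norm_num) (by norm_num) hc0
    set K := S (2 * t0) * t0 ^ δ with hK
    have hS2 : 0 < S (2 * t0) := hSpos _ (by linarith) (by linarith)
    have hKpos : 0 < K := mul_pos hS2 (Real.rpow_pos_of_pos ht0 _)
    have hbase : ∀ t, t0 ≤ t → t ≤ 2 * t0 → K * t ^ (-δ) ≤ S t := by
      intro t h1 h2
      have h3 : t ^ (-δ) ≤ t0 ^ (-δ) := Real.rpow_le_rpow_of_nonpos ht0 h1 (by linarith)
      calc K * t ^ (-δ) ≤ K * t0 ^ (-δ) := by gcongr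
        _ = S (2 * t0) := by
          rw [hK, mul_assoc, ← Real.rpow_add ht0]; simp
        _ ≤ S t := hanti t _ (by linarith) h2 (by linarith)
    have hind : ∀ n : ℕ, ∀ t, t ≤ 2 * t0 → t0 / 2 ^ n ≤ t → K * t ^ (-δ) ≤ S t := by
      intro n
      induction n with
      | zero => intro t h1 h2; exact hbase t (by simpa using h2) h1
      | succ n ih =>
        intro t h1 h2
        rcases le_total t0 t with h | h
        · exact hbase t h h1
        · have htp : 0 < t := lt_of_lt_of_le (by positivity) h2
          have h4 : t0 / 2 ^ n ≤ 2 * t := by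
            have : t0 / 2 ^ n = 2 * (t0 / 2 ^ (n+1)) := by field_simp; ring
            linarith
          have h5 := ih (2 * t) (by linarith) h4
          rw [Real.mul_rpow (by norm_num) htp.le, hδc] at h5
          have h6 := hrat t htp h
          have h7 : c * (K * t ^ (-δ)) ≤ c * S t := by linarith
          exact le_of_mul_le_mul_left h7 hc0
    have hlow : ∀ t, 0 < t → t ≤ t0 → K * t ^ (-δ) ≤ S t := by
      intro t ht htt
      obtain ⟨n, hn⟩ := pow_unbounded_of_one_lt (t0 / t) (one_lt_two (α := ℝ))
      apply hind n t (by linarith)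
      rw [div_lt_iff₀ ht] at hn
      rw [div_le_iff₀ (by positivity)]
      linarith
    have hmu : ∀ t, 0 < t → t ≤ t0 →
        Real.log ((1 - c) * K) + (1 + δ) * Real.log (1 / t) ≤ Real.log (μ t) := by
      intro t ht htt
      have h1 := hup t ht (by linarith)
      have h2 := hrat t ht htt
      have h3 := hlow t ht htt
      have hcp : 0 < 1 - c := by linarith
      have hp : 0 < t ^ (-δ) := Real.rpow_pos_of_pos ht _
      have h4 : (1 - c) * K * t ^ (-δ) ≤ t * μ t := by
        have : (1 - c) * (K * t ^ (-δ)) ≤ (1 - c) * S t := by gcongr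
        linarith
      have h5 := Real.log_le_log (by positivity) h4
      rw [Real.log_mul (by positivity) hp.ne', Real.log_rpow ht,
        Real.log_mul ht.ne' (hpos t ⟨ht, by linarith⟩).ne'] at h5
      rw [one_div, Real.log_inv]
      linarith
    have hlog : Tendsto (fun t : ℝ => Real.log (1 / t)) (𝓝[>] (0:ℝ)) atTop := by
      simp only [one_div]
      exact Real.tendsto_log_atTop.comp tendsto_inv_nhdsGT_zero
    have hev : ∀ᶠ t in 𝓝[>] (0:ℝ), 1 + δ / 2 ≤ Real.log (μ t) / Real.log (1 / t) := by
      filter_upwards [Ioo_mem_nhdsGT ht0, hlog.eventually_ge_atTop 1,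
        hlog.eventually_ge_atTop (-Real.log ((1 - c) * K) / (δ / 2))] with t ht h1 h2
      rw [le_div_iff₀ (by linarith)]
      rw [div_le_iff₀ (by positivity)] at h2
      have := hmu t ht.1 ht.2.le
      nlinarith
    rw [Filter.liminf_eq] at hord
    have hbdd : BddAbove {a : ℝ | ∀ᶠ t in 𝓝[>] (0:ℝ), a ≤ Real.log (μ t) / Real.log (1 / t)} := by
      by_contra h
      rw [Real.sSup_of_not_bddAbove h] at hord
      norm_num at hord
    have := le_csSup hbdd hev
    rw [hord] at this
    linarith
end

section
/- Let μ : (0,1] → (0,∞) be a nonincreasing function with liminf_{t→0⁺} (log μ(t))/(log(1/t)) = 1. Define S⁰(t) = ∫_0^t μ(s) ds if ∫_0^1 μ(s) ds < ∞, and S⁰(t) = ∫_t^1 μ(s) ds otherwise. Then 1 is a limit point of S⁰(2t)/S⁰(t) as t → 0⁺; that is, there exists a sequence t_n → 0⁺ with S⁰(2t_n)/S⁰(t_n) → 1. -/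
open Filter MeasureTheory Set Topology

theorem aux_seq (f : ℝ → ℝ)
    (h : ∀ δ > 0, ∀ η > 0, ∃ t, 0 < t ∧ t < η ∧ |f t - 1| < δ) :
    ∃ u : ℕ → ℝ, (∀ n, 0 < u n) ∧ Tendsto u atTop (𝓝 0) ∧
      Tendsto (fun n => f (u n)) atTop (𝓝 1) := by
  have h' : ∀ n : ℕ, ∃ t, 0 < t ∧ t < 1 / ((n:ℝ) + 1) ∧ |f t - 1| < 1 / ((n:ℝ) + 1) :=
    fun n => h _ (by positivity) _ (by positivity)
  choose u h1 h2 h3 using h'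
  refine ⟨u, h1, ?_, ?_⟩
  · exact squeeze_zero (fun n => (h1 n).le) (fun n => (h2 n).le) tendsto_one_div_add_atTop_nhds_zero_nat
  · rw [tendsto_iff_dist_tendsto_zero]
    refine squeeze_zero (fun n => dist_nonneg) (fun n => ?_) tendsto_one_div_add_atTop_nhds_zero_nat
    rw [Real.dist_eq]; exact (h3 n).le

theorem aux_lower {f : ℝ → ℝ} {l : Filter ℝ} (h : Filter.liminf f l = 1) (a : ℝ) (ha : a < 1) :
    ∀ᶠ t in l, a ≤ f t := by
  rw [Filter.liminf_eq] at h
  have hne : {a | ∀ᶠ n in l, a ≤ f n}.Nonempty := by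
    by_contra hc
    rw [Set.not_nonempty_iff_eq_empty] at hc
    rw [hc, Real.sSup_empty] at h
    norm_num at h
  obtain ⟨b, hb, hab⟩ := exists_lt_of_lt_csSup hne (h ▸ ha)
  exact Filter.Eventually.mono hb (fun t ht => hab.le.trans ht)

theorem aux_upper {f : ℝ → ℝ} {l : Filter ℝ} (h : Filter.liminf f l = 1) (b : ℝ) (hb : 1 < b)
    (hf : ∀ᶠ t in l, b ≤ f t) : False := by
  rw [Filter.liminf_eq] at h
  have hbd : BddAbove {a | ∀ᶠ n in l, a ≤ f n} := by
    by_contra hc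
    rw [Real.sSup_of_not_bddAbove hc] at h
    norm_num at h
  have := le_csSup hbd (show b ∈ {a | ∀ᶠ n in l, a ≤ f n} from hf)
  linarith

theorem aux_le {g : ℝ → ℝ} {a b c : ℝ} (hab : a ≤ b) (hi : IntegrableOn g (Ioc a b) volume)
    (h : ∀ x ∈ Ioc a b, c ≤ g x) : (b - a) * c ≤ ∫ s in Ioc a b, g s := by
  have := setIntegral_mono_on (f := fun _ => c) (by simp) hi measurableSet_Ioc h
  simpa [hab] using this

theorem aux_ge {g : ℝ → ℝ} {a b c : ℝ} (hab : a ≤ b) (hi : IntegrableOn g (Ioc a b) volume)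
    (h : ∀ x ∈ Ioc a b, g x ≤ c) : ∫ s in Ioc a b, g s ≤ (b - a) * c := by
  have := setIntegral_mono_on (g := fun _ => c) hi (by simp) measurableSet_Ioc h
  simpa [hab] using this

theorem aux_split {g : ℝ → ℝ} {a b c : ℝ} (hab : a ≤ b) (hbc : b ≤ c)
    (hi : IntegrableOn g (Ioc a c) volume) :
    ∫ s in Ioc a c, g s = (∫ s in Ioc a b, g s) + ∫ s in Ioc b c, g s := by
  rw [← Ioc_union_Ioc_eq_Ioc hab hbc]
  exact setIntegral_union (Set.Ioc_disjoint_Ioc_of_le le_rfl) measurableSet_Ioc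
    (hi.mono_set (Ioc_subset_Ioc_right hbc)) (hi.mono_set (Ioc_subset_Ioc_left hab))

/-- If the order of infinite of a nonincreasing positive `μ` at `0` is `1`,
then `μ` is `0`-eccentric: `1` is a limit point of `S⁰(2t)/S⁰(t)` as `t → 0⁺`. -/
theorem zero_eccentric_of_order_one
    (μ S : ℝ → ℝ)
    (hpos : ∀ t ∈ Set.Ioc (0:ℝ) 1, 0 < μ t)
    (hmono : ∀ s ∈ Set.Ioc (0:ℝ) 1, ∀ t ∈ Set.Ioc (0:ℝ) 1, s ≤ t → μ t ≤ μ s)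
    (hord : Filter.liminf (fun t => Real.log (μ t) / Real.log (1 / t)) (𝓝[>] (0:ℝ)) = 1)
    (hS₁ : IntegrableOn μ (Set.Ioc (0:ℝ) 1) volume →
      ∀ t ∈ Set.Ioc (0:ℝ) 1, S t = ∫ s in Set.Ioc 0 t, μ s)
    (hS₂ : ¬ IntegrableOn μ (Set.Ioc (0:ℝ) 1) volume →
      ∀ t ∈ Set.Ioc (0:ℝ) 1, S t = ∫ s in Set.Ioc t 1, μ s) :
    ∃ u : ℕ → ℝ, (∀ n, 0 < u n) ∧ Tendsto u atTop (𝓝 0) ∧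
      Tendsto (fun n => S (2 * u n) / S (u n)) atTop (𝓝 1) := by
  apply aux_seq (fun t => S (2 * t) / S t)
  by_contra hcon
  push Not at hcon
  obtain ⟨δ, hδ, η', hη', hc'⟩ := hcon
  obtain ⟨t0, ht0, ht0', ht0h⟩ : ∃ t0 : ℝ, 0 < t0 ∧ t0 < η' ∧ t0 < 1 / 2 := by
    refine ⟨min η' (1 / 2) / 2, by positivity, ?_, ?_⟩
    · have := min_le_left η' (1 / 2); linarith
    · have := min_le_right η' (1 / 2); linarith
  have hc : ∀ t, 0 < t → t ≤ t0 → δ ≤ |S (2 * t) / S t - 1| :=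
    fun t h1 h2 => hc' t h1 (by linarith)
  have hl2 : 0 < Real.log 2 := Real.log_pos (by norm_num)
  have hseq : ∀ n : ℕ, 0 < t0 / 2 ^ n ∧ t0 / 2 ^ n ≤ t0 := fun n =>
    ⟨by positivity, div_le_self ht0.le (one_le_pow₀ (by norm_num))⟩
  have hseq2 : ∀ n : ℕ, 2 * (t0 / 2 ^ (n + 1)) = t0 / 2 ^ n := fun n => by
    field_simp; ring
  have hlogseq : ∀ n : ℕ, Real.log (t0 / 2 ^ n) = Real.log t0 - n * Real.log 2 := fun n => by
    rw [Real.log_div ht0.ne' (by positivity), Real.log_pow]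
  by_cases hint : IntegrableOn μ (Set.Ioc (0:ℝ) 1) volume
  · have hS := hS₁ hint
    have hi : ∀ t ≤ (1:ℝ), IntegrableOn μ (Ioc 0 t) volume := fun t ht =>
      hint.mono_set (Ioc_subset_Ioc_right ht)
    have hlow : ∀ t, 0 < t → t ≤ 1 → t * μ t ≤ S t := by
      intro t h0 h1
      rw [hS t ⟨h0, h1⟩]
      have := aux_le h0.le (hi t h1) (c := μ t)
        (fun x hx => hmono x ⟨hx.1, hx.2.trans h1⟩ t ⟨h0, h1⟩ hx.2)
      simpa using this
    have hSpos : ∀ t, 0 < t → t ≤ 1 → 0 < S t := fun t h0 h1 =>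
      (mul_pos h0 (hpos t ⟨h0, h1⟩)).trans_le (hlow t h0 h1)
    have hdbl : ∀ t, 0 < t → t ≤ t0 → (1 + δ) * S t ≤ S (2 * t) := by
      intro t h0 h1
      have hp := hSpos t h0 (by linarith)
      have hge : S t ≤ S (2 * t) := by
        rw [hS t ⟨h0, by linarith⟩, hS (2 * t) ⟨by linarith, by linarith⟩,
          aux_split (b := t) h0.le (by linarith) (hi (2 * t) (by linarith))]
        have : 0 ≤ ∫ s in Ioc t (2 * t), μ s := by
          apply setIntegral_nonneg measurableSet_Ioc
          intro x hx
          exact (hpos x ⟨by linarith [hx.1], by linarith [hx.2]⟩).le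
        linarith
      have := hc t h0 h1
      have h2 : 1 ≤ S (2 * t) / S t := by rwa [le_div_iff₀ hp, one_mul]
      rw [abs_of_nonneg (by linarith)] at this
      rw [← le_div_iff₀ hp]; linarith
    have hL : 0 < Real.log (1 + δ) := Real.log_pos (by linarith)
    have hlogS : ∀ n : ℕ, Real.log (S (t0 / 2 ^ n)) ≤ Real.log (S t0) - n * Real.log (1 + δ) := by
      intro n
      induction n with
      | zero => simp
      | succ n ih =>
        have h1 := hdbl _ (hseq (n+1)).1 (hseq (n+1)).2
        rw [hseq2] at h1
        have hp := hSpos _ (hseq (n+1)).1 ((hseq (n+1)).2.trans (by linarith))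
        have h2 := Real.log_le_log (by positivity) h1
        rw [Real.log_mul (by positivity) hp.ne'] at h2
        push_cast
        linarith
    set ε := Real.log (1 + δ) / (2 * Real.log 2) with hε
    have hεp : 0 < ε := by positivity
    have hεl : ε * Real.log 2 = Real.log (1 + δ) / 2 := by rw [hε]; field_simp
    have hev := aux_lower hord (1 - ε) (by linarith)
    have htend : Tendsto (fun n : ℕ => t0 / 2 ^ n) atTop (𝓝[>] (0:ℝ)) := by
      rw [tendsto_nhdsWithin_iff]
      refine ⟨?_, Eventually.of_forall fun n => (hseq n).1⟩
      exact tendsto_const_nhds.div_atTop (tendsto_pow_atTop_atTop_of_one_lt (by norm_num))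
    have hbig : ∀ᶠ n : ℕ in atTop, (Real.log (S t0) - ε * Real.log t0) / (Real.log (1 + δ) / 2) < n :=
      tendsto_natCast_atTop_atTop.eventually_gt_atTop _
    obtain ⟨n, h1, h2⟩ := ((htend.eventually hev).and hbig).exists
    rw [div_lt_iff₀ (by positivity)] at h2
    obtain ⟨hn0, hn1⟩ := hseq n
    have h3 := hlogS n
    have h4 := hlogseq n
    generalize t0 / 2 ^ n = t at *
    have hlt : 0 < Real.log (1 / t) := Real.log_pos (by rw [lt_div_iff₀ hn0]; linarith)
    rw [le_div_iff₀ hlt] at h1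
    rw [one_div, Real.log_inv] at h1
    have hmp := hpos t ⟨hn0, by linarith⟩
    have h5 := Real.log_le_log (by positivity) (hlow t hn0 (by linarith))
    rw [Real.log_mul hn0.ne' hmp.ne'] at h5
    have h6 : ε * Real.log t = ε * Real.log t0 - n * (Real.log (1 + δ) / 2) := by
      rw [h4, ← hεl]; ring
    linarith
  · have hS := hS₂ hint
    have hi : ∀ t, 0 < t → ∀ r ≤ (1:ℝ), IntegrableOn μ (Ioc t r) volume := fun t ht r hr => by
      have hanti : AntitoneOn μ (Icc t 1) := fun x hx y hy hxy =>
        hmono x ⟨ht.trans_le hx.1, hx.2⟩ y ⟨ht.trans_le hy.1, hy.2⟩ hxy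
      exact (hanti.integrableOn_isCompact isCompact_Icc).mono_set
        (Ioc_subset_Icc_self.trans (Icc_subset_Icc_right hr))
    have hSpos : ∀ t, 0 < t → t < 1 → 0 < S t := by
      intro t h0 h1
      rw [hS t ⟨h0, h1.le⟩]
      have := aux_le h1.le (hi t h0 1 le_rfl) (c := μ 1)
        (fun x hx => hmono x ⟨h0.trans hx.1, hx.2⟩ 1 ⟨by norm_num, le_rfl⟩ hx.2)
      have h2 := mul_pos (sub_pos.2 h1) (hpos 1 ⟨by norm_num, le_rfl⟩)
      linarith
    have hSanti : ∀ t r, 0 < t → t ≤ r → r ≤ 1 → S r ≤ S t := by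
      intro t r h0 h1 h2
      rw [hS t ⟨h0, h1.trans h2⟩, hS r ⟨h0.trans_le h1, h2⟩, aux_split h1 h2 (hi t h0 1 le_rfl)]
      have : 0 ≤ ∫ s in Ioc t r, μ s := by
        apply setIntegral_nonneg measurableSet_Ioc
        intro x hx
        exact (hpos x ⟨by linarith [hx.1], by linarith [hx.2]⟩).le
      linarith
    have hup : ∀ t, 0 < t → t ≤ 1 / 2 → S t ≤ t * μ t + S (2 * t) := by
      intro t h0 h1
      rw [hS t ⟨h0, by linarith⟩, hS (2 * t) ⟨by linarith, by linarith⟩,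
        aux_split (b := 2 * t) (by linarith) (by linarith) (hi t h0 1 le_rfl)]
      have := aux_ge (by linarith) (hi t h0 (2 * t) (by linarith)) (c := μ t)
        (fun x hx => hmono t ⟨h0, by linarith⟩ x ⟨h0.trans hx.1, by linarith [hx.2]⟩ hx.1.le)
      have h3 : (2 * t - t) * μ t = t * μ t := by ring
      linarith
    have habs : ∀ t, 0 < t → t ≤ t0 → δ ≤ 1 - S (2 * t) / S t := by
      intro t h0 h1
      have hp := hSpos t h0 (by linarith)
      have := hc t h0 h1
      have h2 : S (2 * t) / S t ≤ 1 := by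
        rw [div_le_one hp]; exact hSanti _ _ h0 (by linarith) (by linarith)
      rwa [abs_of_nonpos (by linarith), neg_sub] at this
    have hdbl : ∀ t, 0 < t → t ≤ t0 → S (2 * t) ≤ (1 - δ) * S t := by
      intro t h0 h1
      have hp := hSpos t h0 (by linarith)
      rw [← div_le_iff₀ hp]
      linarith [habs t h0 h1]
    have hδ1 : 0 < 1 - δ := by
      have h1 := habs t0 ht0 le_rfl
      have h2 := div_pos (hSpos (2 * t0) (by linarith) (by linarith)) (hSpos t0 ht0 (by linarith))
      linarith
    obtain ⟨L, hLdef⟩ : ∃ L, L = - Real.log (1 - δ) := ⟨_, rfl⟩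
    have hL : 0 < L := by
      have := Real.log_neg hδ1 (by linarith); linarith
    have hlogS : ∀ n : ℕ, Real.log (S t0) + n * L ≤ Real.log (S (t0 / 2 ^ n)) := by
      intro n
      induction n with
      | zero => simp
      | succ n ih =>
        have h1 := hdbl _ (hseq (n+1)).1 (hseq (n+1)).2
        rw [hseq2] at h1
        have hp := hSpos _ (hseq (n+1)).1 ((hseq (n+1)).2.trans_lt (by linarith))
        have hp' := hSpos _ (hseq n).1 ((hseq n).2.trans_lt (by linarith))
        have h2 := Real.log_le_log hp' h1
        rw [Real.log_mul (by positivity) hp.ne'] at h2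
        push_cast
        linarith
    obtain ⟨k, hk⟩ : ∃ k, k = L / Real.log 2 := ⟨_, rfl⟩
    have hkp : 0 < k := by rw [hk]; positivity
    have hkL : k * Real.log 2 = L := by rw [hk]; field_simp
    obtain ⟨C, hC⟩ : ∃ C, C = Real.log δ + Real.log (S t0) + k * Real.log t0 - L := ⟨_, rfl⟩
    have hmain : ∀ t, 0 < t → t ≤ t0 → (1 + k) * (- Real.log t) + C ≤ Real.log (μ t) := by
      intro t h0 h1
      obtain ⟨n, hn1, hn2⟩ := exists_nat_pow_near (x := t0 / t) (y := (2:ℝ))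
        (by rwa [le_div_iff₀ h0, one_mul]) (by norm_num)
      have hle : t ≤ t0 / 2 ^ n := by
        rw [le_div_iff₀ h0] at hn1
        rw [le_div_iff₀ (by positivity)]; linarith
      have h2 := Real.log_le_log (by positivity) hn2.le
      rw [Real.log_div ht0.ne' h0.ne', Real.log_pow] at h2
      push_cast at h2
      have h3 := mul_le_mul_of_nonneg_left h2 hkp.le
      have h4 : k * (((n:ℝ) + 1) * Real.log 2) = n * L + L := by rw [← hkL]; ring
      have hp := hSpos t h0 (by linarith)
      have hmp := hpos t ⟨h0, by linarith⟩
      have h5 := Real.log_le_log (hSpos _ (hseq n).1 ((hseq n).2.trans_lt (by linarith)))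
        (hSanti _ _ h0 hle ((hseq n).2.trans (by linarith)))
      have h6 : δ * S t ≤ t * μ t := by
        have := hup t h0 (by linarith)
        have := hdbl t h0 h1
        linarith
      have h7 := Real.log_le_log (by positivity) h6
      rw [Real.log_mul hδ.ne' hp.ne', Real.log_mul h0.ne' hmp.ne'] at h7
      have := hlogS n
      linarith
    refine aux_upper hord (1 + k / 2) (by linarith) ?_
    have hlogt : ∀ᶠ t in 𝓝[>] (0:ℝ), Real.log t < 2 * C / k :=
      Real.tendsto_log_nhdsGT_zero.eventually_lt_atBot _
    filter_upwards [hlogt, Ioc_mem_nhdsGT ht0] with t h1 h2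
    have hlt : 0 < Real.log (1 / t) :=
      Real.log_pos (by rw [lt_div_iff₀ h2.1]; linarith [h2.2])
    rw [le_div_iff₀ hlt, one_div, Real.log_inv]
    have h3 := hmain t h2.1 h2.2
    rw [lt_div_iff₀ hkp] at h1
    linarith
end

section
/- Let μ : [1,∞) → (0,∞) be a nonincreasing function with ∫_1^∞ μ(s) ds = ∞, and suppose that liminf_{t→∞} (log(1/μ(t)))/(log t) = 1. Define S(t) = ∫_1^t μ(s) ds for t ≥ 1. Then liminf_{t→∞} S(2t)/S(t) = 1. -/
open Filter MeasureTheory Set Topology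

theorem liminf_order_one_at_infty_of_nonintegrable_implies_liminf_ratio_one
    (μ S : ℝ → ℝ)
    (hpos : ∀ t : ℝ, 1 ≤ t → 0 < μ t)
    (hmono : ∀ s t : ℝ, 1 ≤ s → s ≤ t → μ t ≤ μ s)
    (hint : ¬ IntegrableOn μ (Set.Ici (1:ℝ)) volume)
    (hord : Filter.liminf (fun t => Real.log (1 / μ t) / Real.log t) Filter.atTop = 1)
    (hS : ∀ t : ℝ, 1 ≤ t → S t = ∫ s in Set.Ioc 1 t, μ s) :
    Filter.liminf (fun t => S (2 * t) / S t) Filter.atTop = 1 := by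
  have hI : ∀ a b : ℝ, 1 ≤ a → IntegrableOn μ (Set.Ioc a b) volume := by
    intro a b ha
    have h : AntitoneOn μ (Set.Icc a b) := fun x hx y _ hxy =>
      hmono x y (ha.trans hx.1) hxy
    exact (h.integrableOn_isCompact isCompact_Icc).mono_set Ioc_subset_Icc_self
  have hadd : ∀ t : ℝ, 1 ≤ t → S (2 * t) = S t + ∫ s in Set.Ioc t (2 * t), μ s := by
    intro t ht
    rw [hS t ht, hS (2 * t) (by linarith), ← setIntegral_union
      (Ioc_disjoint_Ioc_of_le le_rfl) measurableSet_Ioc (hI _ _ le_rfl) (hI _ _ ht),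
      Ioc_union_Ioc_eq_Ioc ht (by linarith)]
  have hup : ∀ t : ℝ, 1 ≤ t → ∫ s in Set.Ioc t (2 * t), μ s ≤ t * μ t := by
    intro t ht
    calc ∫ s in Set.Ioc t (2 * t), μ s ≤ ∫ s in Set.Ioc t (2 * t), μ t := by
          apply setIntegral_mono_on (hI _ _ ht) (by simp) measurableSet_Ioc
          intro x hx
          exact hmono t x ht hx.1.le
      _ = t * μ t := by
          simp [Measure.real]
          left
          rw [ENNReal.toReal_ofReal (by linarith)]
          ring
  have hlow : ∀ t : ℝ, 1 ≤ t → 0 ≤ ∫ s in Set.Ioc t (2 * t), μ s := by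
    intro t ht
    exact setIntegral_nonneg measurableSet_Ioc fun x hx => (hpos x (ht.trans hx.1.le)).le
  have hSpos : ∀ t : ℝ, 1 < t → 0 < S t := by
    intro t ht
    rw [hS t ht.le]
    have : ∫ s in Set.Ioc 1 t, μ t ≤ ∫ s in Set.Ioc 1 t, μ s := by
      apply setIntegral_mono_on (by simp) (hI _ _ le_rfl) measurableSet_Ioc
      intro x hx
      exact hmono x t hx.1.le hx.2
    refine lt_of_lt_of_le ?_ this
    have h1 : 0 < t - 1 := by linarith
    simp only [integral_const, smul_eq_mul, Measure.real, Measure.restrict_apply_univ,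
      Real.volume_Ioc, ENNReal.toReal_ofReal h1.le]
    exact mul_pos h1 (hpos t ht.le)
  rw [liminf_eq] at hord ⊢
  apply IsGreatest.csSup_eq
  constructor
  · simp only [mem_setOf_eq]
    filter_upwards [eventually_gt_atTop 1] with t ht
    rw [le_div_iff₀ (hSpos t ht), hadd t ht.le]
    linarith [hlow t ht.le]
  · intro a ha
    by_contra! h1
    simp only [mem_setOf_eq] at ha
    set r := Real.sqrt a with hr
    have hrr : r * r = a := Real.mul_self_sqrt (by linarith)
    have hr1 : 1 < r := by rw [hr]; exact Real.lt_sqrt_of_sq_lt (by linarith)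
    set c := Real.logb 2 r with hc
    have hc0 : 0 < c := Real.logb_pos (by norm_num) hr1
    have h2c : (2:ℝ) ^ c = r := Real.rpow_logb (by norm_num) (by norm_num) (by linarith)
    have hne : {a : ℝ | ∀ᶠ n in atTop, a ≤ Real.log (1 / μ n) / Real.log n}.Nonempty := by
      by_contra hn
      rw [not_nonempty_iff_eq_empty] at hn
      rw [hn] at hord
      simp at hord
    obtain ⟨d, hd, hcd⟩ := exists_lt_of_lt_csSup hne (show 1 - c < _ by rw [hord]; linarith)
    simp only [mem_setOf_eq] at hd
    have key : ∀ᶠ t : ℝ in atTop, S t * (a - 1) ≤ t ^ c := by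
      filter_upwards [eventually_gt_atTop 1, ha, hd] with t ht hat hdt
      have hl : 0 < Real.log t := Real.log_pos ht
      have hm := hpos t ht.le
      rw [le_div_iff₀ (hSpos t ht), hadd t ht.le] at hat
      rw [le_div_iff₀ hl, one_div, Real.log_inv] at hdt
      have h3 : t * μ t ≤ t ^ c := by
        rw [Real.le_rpow_iff_log_le (by positivity) (by linarith),
          Real.log_mul (by linarith) hm.ne']
        nlinarith
      linarith [hup t ht.le]
    obtain ⟨T, hT⟩ := eventually_atTop.1 (key.and ha)
    set t0 := max T 2
    have ht0 : 2 ≤ t0 := le_max_right _ _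
    have hge : ∀ n : ℕ, t0 ≤ 2 ^ n * t0 := fun n =>
      le_mul_of_one_le_left (by linarith) (one_le_pow₀ (by norm_num))
    have hTn : ∀ n : ℕ, T ≤ 2 ^ n * t0 := fun n => (le_max_left _ _).trans (hge n)
    have hgrow : ∀ n : ℕ, a ^ n * S t0 ≤ S (2 ^ n * t0) := by
      intro n
      induction n with
      | zero => simp
      | succ k ih =>
        have h := (hT _ (hTn k)).2
        rw [le_div_iff₀ (hSpos _ (by linarith [hge k]))] at h
        calc a ^ (k+1) * S t0 = a * (a ^ k * S t0) := by ring
          _ ≤ a * S (2 ^ k * t0) := by gcongr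
          _ ≤ _ := h
          _ = _ := by congr 1; ring
    have hS0 : 0 < S t0 := hSpos _ (by linarith)
    have hbd : ∀ n : ℕ, r ^ n * (S t0 * (a - 1)) ≤ t0 ^ c := by
      intro n
      have h := (hT _ (hTn n)).1
      have e : ((2:ℝ) ^ n * t0) ^ c = r ^ n * t0 ^ c := by
        rw [Real.mul_rpow (by positivity) (by linarith), ← h2c, ← Real.rpow_natCast,
          ← Real.rpow_natCast, ← Real.rpow_mul (by norm_num), ← Real.rpow_mul (by norm_num),
          mul_comm]
        ring_nf
      rw [e] at h
      have hrn : 0 < r ^ n := by positivity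
      have h4 : a ^ n * S t0 * (a - 1) ≤ r ^ n * t0 ^ c :=
        (mul_le_mul_of_nonneg_right (hgrow n) (by linarith)).trans h
      have h5 : a ^ n = r ^ n * r ^ n := by rw [← hrr, mul_pow]
      rw [h5] at h4
      refine le_of_mul_le_mul_left ?_ hrn
      linarith
    have hK : 0 < S t0 * (a - 1) := mul_pos hS0 (by linarith)
    obtain ⟨n, hn⟩ := pow_unbounded_of_one_lt (t0 ^ c / (S t0 * (a - 1))) hr1
    rw [div_lt_iff₀ hK] at hn
    linarith [hbd n]
end

section
/- Let μ : [1,∞) → (0,∞) be a nonincreasing function with liminf_{t→∞} (log(1/μ(t)))/(log t) = 1. Define S^∞(t) = ∫_1^t μ(s) ds if ∫_1^∞ μ(s) ds = ∞, and S^∞(t) = ∫_t^∞ μ(s) ds otherwise. Then 1 is a limit point of S^∞(2t)/S^∞(t) as t → ∞; that is, there exists a sequence t_n → ∞ with S^∞(2t_n)/S^∞(t_n) → 1. -/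
open Filter MeasureTheory Set Topology

lemma aux_io (μ : ℝ → ℝ) (hmono : ∀ s t : ℝ, 1 ≤ s → s ≤ t → μ t ≤ μ s) (a b : ℝ) (ha : 1 ≤ a) :
    IntegrableOn μ (Ioc a b) volume := by
  have h : AntitoneOn μ (Icc a b) := fun x hx y _ hxy => hmono x y (ha.trans hx.1) hxy
  exact (h.integrableOn_isCompact isCompact_Icc).mono_set Ioc_subset_Icc_self

lemma aux_up (μ : ℝ → ℝ) (hmono : ∀ s t : ℝ, 1 ≤ s → s ≤ t → μ t ≤ μ s) (a b : ℝ) (ha : 1 ≤ a)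
    (hab : a ≤ b) : ∫ s in Ioc a b, μ s ≤ (b - a) * μ a := by
  have h := setIntegral_mono_on (μ := volume) (aux_io μ hmono a b ha)
    (g := fun _ => μ a) (by simp) measurableSet_Ioc
    (fun x hx => hmono a x ha hx.1.le)
  simpa [measureReal_def, ENNReal.toReal_ofReal (sub_nonneg.2 hab)] using h

lemma aux_lo (μ : ℝ → ℝ) (hmono : ∀ s t : ℝ, 1 ≤ s → s ≤ t → μ t ≤ μ s) (a b : ℝ) (ha : 1 ≤ a)
    (hab : a ≤ b) : (b - a) * μ b ≤ ∫ s in Ioc a b, μ s := by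
  have h := setIntegral_mono_on (μ := volume) (f := fun _ => μ b) (by simp)
    (aux_io μ hmono a b ha) measurableSet_Ioc
    (fun x hx => hmono x b (ha.trans hx.1.le) hx.2)
  simpa [measureReal_def, ENNReal.toReal_ofReal (sub_nonneg.2 hab)] using h

lemma aux_ev (f : ℝ → ℝ) (h : Filter.liminf f atTop = 1) (a : ℝ) (ha : a < 1) :
    ∀ᶠ t in atTop, a ≤ f t := by
  rw [Filter.liminf_eq] at h
  have hne : {a | ∀ᶠ t in atTop, a ≤ f t}.Nonempty := by
    by_contra hn
    rw [not_nonempty_iff_eq_empty] at hn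
    rw [hn] at h; simp at h
  obtain ⟨b, hb, hab⟩ := exists_lt_of_lt_csSup hne (h.symm ▸ ha)
  exact hb.mono fun t ht => hab.le.trans ht

lemma aux_fr (f : ℝ → ℝ) (h : Filter.liminf f atTop = 1) (a : ℝ) (ha : 1 < a) :
    ∃ᶠ t in atTop, f t < a := by
  rw [Filter.liminf_eq] at h
  have hb : BddAbove {a | ∀ᶠ t in atTop, a ≤ f t} := by
    by_contra hn
    rw [Real.sSup_of_not_bddAbove hn] at h; simp at h
  intro hc
  have : a ≤ 1 := h ▸ le_csSup hb (by filter_upwards [hc] with t ht; exact not_lt.1 ht)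
  linarith

theorem infty_eccentric_of_order_one
    (μ S : ℝ → ℝ)
    (hpos : ∀ t : ℝ, 1 ≤ t → 0 < μ t)
    (hmono : ∀ s t : ℝ, 1 ≤ s → s ≤ t → μ t ≤ μ s)
    (hord : Filter.liminf (fun t => Real.log (1 / μ t) / Real.log t) Filter.atTop = 1)
    (hS₁ : ¬ IntegrableOn μ (Set.Ici (1:ℝ)) volume →
      ∀ t : ℝ, 1 ≤ t → S t = ∫ s in Set.Ioc 1 t, μ s)
    (hS₂ : IntegrableOn μ (Set.Ici (1:ℝ)) volume →
      ∀ t : ℝ, 1 ≤ t → S t = ∫ s in Set.Ioi t, μ s) :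
    ∃ u : ℕ → ℝ, Tendsto u atTop atTop ∧
      Tendsto (fun n => S (2 * u n) / S (u n)) atTop (𝓝 1) := by
  by_cases H : ∀ n : ℕ, ∃ t : ℝ, (n : ℝ) ≤ t ∧ |S (2 * t) / S t - 1| < 1 / ((n : ℝ) + 1)
  · choose u hu1 hu2 using H
    refine ⟨u, tendsto_atTop_mono hu1 tendsto_natCast_atTop_atTop, ?_⟩
    rw [tendsto_iff_dist_tendsto_zero]
    refine squeeze_zero (fun _ => dist_nonneg) (fun n => ?_)
      (tendsto_one_div_add_atTop_nhds_zero_nat (𝕜 := ℝ))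
    rw [Real.dist_eq]; exact (hu2 n).le
  exfalso
  push Not at H
  obtain ⟨N, hN⟩ := H
  obtain ⟨c, hc, hcN⟩ : ∃ c : ℝ, 0 < c ∧ ∀ t : ℝ, (N : ℝ) ≤ t → c ≤ |S (2 * t) / S t - 1| :=
    ⟨_, by positivity, hN⟩
  clear hN
  by_cases hint : IntegrableOn μ (Set.Ici (1:ℝ)) volume
  · have hS := hS₂ hint
    have hsplit : ∀ t, 1 ≤ t → S t = (∫ s in Ioc t (2 * t), μ s) + S (2 * t) := by
      intro t ht
      rw [hS t ht, hS (2 * t) (by linarith), ← Ioc_union_Ioi_eq_Ioi (by linarith : t ≤ 2 * t)]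
      refine setIntegral_union (Ioc_disjoint_Ioi le_rfl) measurableSet_Ioi
        (aux_io μ hmono _ _ ht) (hint.mono_set fun x hx => ?_)
      have : 2 * t < x := hx
      exact mem_Ici.2 (by linarith)
    have hlo : ∀ t, 1 ≤ t → t * μ (2 * t) ≤ ∫ s in Ioc t (2 * t), μ s := fun t ht => by
      have := aux_lo μ hmono t (2 * t) ht (by linarith)
      linarith
    have hS0 : ∀ t, 1 ≤ t → 0 ≤ S t := fun t ht => by
      rw [hS t ht]
      refine setIntegral_nonneg measurableSet_Ioi fun x hx => (hpos x ?_).le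
      exact ht.trans (le_of_lt hx)
    have hgt : ∀ t, 1 ≤ t → t * μ (2 * t) + S (2 * t) ≤ S t := fun t ht => by
      linarith [hlo t ht, hsplit t ht]
    have htm : ∀ t, 1 ≤ t → 0 < t * μ (2 * t) := fun t ht =>
      mul_pos (by linarith) (hpos _ (by linarith))
    have hSp : ∀ t, 1 ≤ t → 0 < S t := fun t ht => by
      linarith [hgt t ht, hS0 (2 * t) (by linarith), htm t ht]
    set T : ℝ := max 1 N
    have hT1 : 1 ≤ T := le_max_left _ _
    have hstep : ∀ t, T ≤ t → S (2 * t) ≤ (1 - c) * S t := by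
      intro t ht
      have ht1 : 1 ≤ t := hT1.trans ht
      have h := hcN t ((le_max_right _ _).trans ht)
      have hp := hSp t ht1
      have hlt : S (2 * t) / S t ≤ 1 := by
        rw [div_le_one hp]; linarith [hgt t ht1, htm t ht1]
      rw [abs_of_nonpos (by linarith)] at h
      rw [← div_le_iff₀ hp]; linarith
    have hc1 : c < 1 := by
      by_contra hcc
      have h1 := hstep T le_rfl
      have h2 := hSp (2 * T) (by linarith)
      have h3 := hSp T hT1
      nlinarith
    have hit : ∀ n : ℕ, S (2 ^ n * T) ≤ (1 - c) ^ n * S T := by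
      intro n
      induction n with
      | zero => simp
      | succ n ih =>
        have h1 : T ≤ 2 ^ n * T := le_mul_of_one_le_left (by linarith) (one_le_pow₀ (by norm_num))
        have := hstep _ h1
        calc S (2 ^ (n+1) * T) = S (2 * (2 ^ n * T)) := by ring_nf
          _ ≤ (1 - c) * S (2 ^ n * T) := this
          _ ≤ (1 - c) * ((1 - c) ^ n * S T) := by
            apply mul_le_mul_of_nonneg_left ih; linarith
          _ = _ := by ring
    have hanti : ∀ s t, 1 ≤ s → s ≤ t → S t ≤ S s := by
      intro s t hs hst
      rw [hS s hs, hS t (hs.trans hst)]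
      refine setIntegral_mono_set (hint.mono_set fun x hx => hs.trans (le_of_lt hx)) ?_
        (HasSubset.Subset.eventuallyLE (Ioi_subset_Ioi hst))
      filter_upwards [ae_restrict_mem measurableSet_Ioi] with x hx
      exact (hpos x (hs.trans (le_of_lt hx))).le
    obtain ⟨ε, hε, h2ε⟩ : ∃ ε : ℝ, 0 < ε ∧ (2:ℝ) ^ (-ε) = 1 - c / 2 := by
      refine ⟨-Real.logb 2 (1 - c / 2), ?_, ?_⟩
      · have := Real.logb_neg (b := 2) (x := 1 - c / 2) (by norm_num) (by linarith) (by linarith)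
        linarith
      · rw [neg_neg]; exact Real.rpow_logb (by norm_num) (by norm_num) (by linarith)
    have hfr := aux_fr _ hord (1 + ε) (by linarith)
    set q : ℝ := (1 - c) / (1 - c / 2) with hq
    have hq0 : 0 ≤ q := div_nonneg (by linarith) (by linarith)
    have hq1 : q < 1 := by rw [hq, div_lt_one (by linarith)]; linarith
    set K : ℝ := (4 * T) ^ (-ε) / 2 / S T with hK
    have hKp : 0 < K := by
      have := hSp T hT1
      positivity
    obtain ⟨M, hM⟩ := exists_pow_lt_of_lt_one hKp hq1
    obtain ⟨t, htl, htf⟩ := (frequently_atTop.1 hfr) (2 * (2 ^ M * T))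
    have hMT : T ≤ 2 ^ M * T := le_mul_of_one_le_left (by linarith) (one_le_pow₀ (by norm_num))
    have ht1 : 1 < t := by linarith
    obtain ⟨n, hn1, hn2⟩ := exists_nat_pow_near (x := t / 2 / T) (y := (2:ℝ))
      (by rw [le_div_iff₀ (by linarith)]; linarith) (by norm_num)
    rw [le_div_iff₀ (by linarith)] at hn1
    rw [div_lt_iff₀ (by linarith)] at hn2
    have hMn : M ≤ n := by
      have : (2:ℝ) ^ M < 2 ^ (n + 1) := by
        have : (2:ℝ) ^ M * T < 2 ^ (n + 1) * T := by linarith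
        exact lt_of_mul_lt_mul_right this (by linarith)
      have := (pow_lt_pow_iff_right₀ (by norm_num : (1:ℝ) < 2)).1 this
      omega
    have hmt : t ^ (-(1 + ε)) < μ t := by
      have hm := hpos t ht1.le
      rw [div_lt_iff₀ (Real.log_pos ht1), one_div, Real.log_inv] at htf
      rw [← Real.log_lt_log_iff (by positivity) hm, Real.log_rpow (by linarith)]
      linarith
    have e1 : t / 2 * μ t ≤ S (t / 2) := by
      have := hgt (t / 2) (by linarith)
      rw [show 2 * (t / 2) = t by ring] at this
      linarith [hSp t ht1.le]
    have e2 : S (t / 2) ≤ (1 - c) ^ n * S T := by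
      refine (hanti _ _ ?_ hn1).trans (hit n)
      exact hT1.trans (le_mul_of_one_le_left (by linarith) (one_le_pow₀ (by norm_num)))
    have e3 : t ^ (-ε) / 2 ≤ t / 2 * μ t := by
      have : t ^ (-ε) = t * t ^ (-(1 + ε)) := by
        rw [show -ε = 1 + (-(1 + ε)) by ring, Real.rpow_add (by linarith), Real.rpow_one]
      rw [this]
      nlinarith
    have e4 : (1 - c / 2) ^ n * (4 * T) ^ (-ε) ≤ t ^ (-ε) := by
      rw [← h2ε, ← Real.rpow_natCast, ← Real.rpow_mul (by norm_num), mul_comm (-ε),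
        Real.rpow_mul (by norm_num), Real.rpow_natCast,
        ← Real.mul_rpow (by positivity) (by positivity)]
      refine Real.rpow_le_rpow_of_nonpos (by linarith) ?_ (by linarith)
      rw [pow_succ] at hn2
      linarith
    have hSTp := hSp T hT1
    have hcn : 0 < (1 - c / 2) ^ n := pow_pos (by linarith) n
    have e5 : K ≤ q ^ n := by
      rw [hK, hq, div_pow, div_le_div_iff₀ hSTp hcn]
      linarith
    have e6 : q ^ n ≤ q ^ M := pow_le_pow_of_le_one hq0 hq1.le hMn
    linarith
  · have hS := hS₁ hint
    have hsplit : ∀ t, 1 ≤ t → S (2 * t) = S t + ∫ s in Ioc t (2 * t), μ s := by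
      intro t ht
      rw [hS t ht, hS (2 * t) (by linarith), ← Ioc_union_Ioc_eq_Ioc ht (by linarith : t ≤ 2 * t)]
      exact setIntegral_union (Ioc_disjoint_Ioc_of_le le_rfl) measurableSet_Ioc
        (aux_io μ hmono _ _ le_rfl) (aux_io μ hmono _ _ ht)
    have hup : ∀ t, 1 ≤ t → S (2 * t) ≤ S t + t * μ t := fun t ht => by
      have := aux_up μ hmono t (2 * t) ht (by linarith)
      linarith [hsplit t ht]
    have hlo : ∀ t, 1 ≤ t → S t ≤ S (2 * t) := fun t ht => by
      have := aux_lo μ hmono t (2 * t) ht (by linarith)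
      have h2 := mul_pos (by linarith : 0 < 2 * t - t) (hpos (2 * t) (by linarith))
      linarith [hsplit t ht]
    have hSp : ∀ t, 1 < t → 0 < S t := fun t ht => by
      have := aux_lo μ hmono 1 t le_rfl ht.le
      have h2 := mul_pos (by linarith : 0 < t - 1) (hpos t ht.le)
      rw [hS t ht.le]; linarith
    obtain ⟨ε, hε, h2ε⟩ : ∃ ε : ℝ, 0 < ε ∧ (2:ℝ) ^ ε = 1 + c / 2 :=
      ⟨Real.logb 2 (1 + c / 2), Real.logb_pos (by norm_num) (by linarith),
        Real.rpow_logb (by norm_num) (by norm_num) (by linarith)⟩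
    obtain ⟨T0, hT0⟩ := eventually_atTop.1 (aux_ev _ hord (1 - ε) (by linarith))
    set T : ℝ := max (max 2 N) T0
    have hT2 : 2 ≤ T := (le_max_left _ _).trans (le_max_left _ _)
    have hTN : N ≤ T := (le_max_right _ _).trans (le_max_left _ _)
    have hT0' : T0 ≤ T := le_max_right _ _
    have hstep : ∀ t, T ≤ t → (1 + c) * S t ≤ S (2 * t) := by
      intro t ht
      have h := hcN t (hTN.trans ht)
      have hp := hSp t (by linarith)
      have hge : 1 ≤ S (2 * t) / S t := by
        rw [one_le_div hp]; exact hlo t (by linarith)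
      rw [abs_of_nonneg (by linarith)] at h
      rw [← le_div_iff₀ hp]; linarith
    have hit : ∀ n : ℕ, (1 + c) ^ n * S T ≤ S (2 ^ n * T) := by
      intro n
      induction n with
      | zero => simp
      | succ n ih =>
        have h1 : T ≤ 2 ^ n * T := le_mul_of_one_le_left (by linarith) (one_le_pow₀ (by norm_num))
        have := hstep _ h1
        calc (1 + c) ^ (n+1) * S T = (1 + c) * ((1 + c) ^ n * S T) := by ring
          _ ≤ (1 + c) * S (2 ^ n * T) := by
            apply mul_le_mul_of_nonneg_left ih; linarith
          _ ≤ S (2 * (2 ^ n * T)) := this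
          _ = _ := by ring_nf
    have hSle : ∀ t, T ≤ t → c * S t ≤ t ^ ε := by
      intro t ht
      have ht1 : 1 < t := by linarith
      have h := hT0 t (hT0'.trans ht)
      rw [le_div_iff₀ (Real.log_pos ht1), one_div, Real.log_inv] at h
      have hm : μ t ≤ t ^ (ε - 1) := by
        rw [← Real.log_le_log_iff (hpos t ht1.le) (by positivity), Real.log_rpow (by linarith)]
        linarith
      have : t ^ ε = t * t ^ (ε - 1) := by
        rw [Real.rpow_sub_one (by linarith)]
        field_simp
      rw [this]
      have h3 := mul_le_mul_of_nonneg_left hm (by linarith : 0 ≤ t)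
      linarith [hstep t ht, hup t ht1.le]
    have hSTp := hSp T (by linarith)
    obtain ⟨n, hn⟩ := pow_unbounded_of_one_lt (T ^ ε / (c * S T))
      (by rw [one_lt_div (by linarith)]; linarith : 1 < (1 + c) / (1 + c / 2))
    have h1 : T ≤ 2 ^ n * T := le_mul_of_one_le_left (by linarith) (one_le_pow₀ (by norm_num))
    have h2 := hSle _ h1
    have h3 : (2 ^ n * T) ^ ε = (1 + c / 2) ^ n * T ^ ε := by
      rw [Real.mul_rpow (by positivity) (by linarith), ← h2ε, ← Real.rpow_natCast,
        ← Real.rpow_natCast, ← Real.rpow_mul (by norm_num), ← Real.rpow_mul (by norm_num),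
        mul_comm ε]
    have h4 := mul_le_mul_of_nonneg_left (hit n) hc.le
    rw [div_pow, div_lt_div_iff₀ (by positivity) (by positivity)] at hn
    rw [h3] at h2
    linarith
end

section
/- Let λ : (0,∞) → [0,∞) be a nonincreasing right-continuous function with lim_{s→0⁺} λ(s) = ∞ and lim_{s→∞} λ(s) = 0, and define μ(t) = inf{ s > 0 : λ(s) ≤ t } for t > 0. Then liminf_{t→∞} (log μ(t))/(log(1/t)) = ( limsup_{s→0⁺} (log λ(s))/(log(1/s)) )^{-1}, where the equality holds in [0,∞] with the conventions 1/0 = ∞ and 1/∞ = 0. -/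
open Filter Set Topology

theorem aux_liminf_le {F G : Filter ℝ} {A B : ℝ → ENNReal}
    (h : ∀ c : ℝ, 0 < c → (∀ᶠ t in F, ENNReal.ofReal c ≤ A t) →
      (∀ᶠ s in G, ENNReal.ofReal c ≤ B s)) : liminf A F ≤ liminf B G := by
  refine le_of_forall_lt fun a ha => ?_
  obtain ⟨c, hac, hcA⟩ := ENNReal.lt_iff_exists_nnreal_btwn.1 ha
  have hc0 : (0 : ℝ) < c := by
    have : (0 : ENNReal) < c := lt_of_le_of_lt (zero_le) hac
    exact_mod_cast this
  have h1 : ∀ᶠ t in F, ENNReal.ofReal c ≤ A t := by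
    filter_upwards [eventually_lt_of_lt_liminf hcA] with t ht
    rw [ENNReal.ofReal_coe_nnreal]; exact ht.le
  have h2 := h c hc0 h1
  refine lt_of_lt_of_le hac ?_
  rw [ENNReal.ofReal_coe_nnreal] at h2
  exact le_liminf_of_le (by isBoundedDefault) h2

/-- The order of infinitesimal of `μ` at `∞` is the inverse of `limsup_{s→0⁺} log λ(s)/log(1/s)`,
the equality holding in `[0,∞]` with the conventions `1/0 = ∞`, `1/∞ = 0`. -/
theorem order_at_infty_eq_inv_limsup_distribution
    (l μ : ℝ → ℝ)
    (hl0 : ∀ s : ℝ, 0 < s → 0 ≤ l s)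
    (hmono : ∀ s t : ℝ, 0 < s → s ≤ t → l t ≤ l s)
    (hrc : ∀ s : ℝ, 0 < s → ContinuousWithinAt l (Set.Ici s) s)
    (hzero : Tendsto l (𝓝[>] (0:ℝ)) atTop)
    (hinfty : Tendsto l atTop (𝓝 0))
    (hμ : ∀ t : ℝ, 0 < t → μ t = sInf {s : ℝ | 0 < s ∧ l s ≤ t}) :
    Filter.liminf (fun t => ENNReal.ofReal (Real.log (μ t) / Real.log (1 / t)))
        Filter.atTop =
      (Filter.limsup (fun s => ENNReal.ofReal (Real.log (l s) / Real.log (1 / s)))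
        (𝓝[>] (0:ℝ)))⁻¹ := by
  have hne : ∀ t : ℝ, 0 < t → {s : ℝ | 0 < s ∧ l s ≤ t}.Nonempty := by
    intro t ht
    obtain ⟨s, h1, h2⟩ := ((hinfty.eventually (eventually_le_nhds ht)).and
      (eventually_gt_atTop 0)).exists
    exact ⟨s, h2, h1⟩
  have hpos : ∀ t : ℝ, 0 < t → 0 < μ t := by
    intro t ht
    rw [hμ t ht]
    obtain ⟨d, hd, h⟩ := mem_nhdsGT_iff_exists_Ioo_subset.1
      (hzero.eventually (eventually_gt_atTop t))
    refine lt_of_lt_of_le hd (le_csInf (hne t ht) ?_)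
    rintro s ⟨hs, hst⟩
    by_contra! hc
    exact absurd (h ⟨hs, hc⟩) (not_lt.2 hst)
  have hgal : ∀ s t : ℝ, 0 < s → 0 < t → (μ t ≤ s ↔ l s ≤ t) := by
    intro s t hs ht
    rw [hμ t ht]
    constructor
    · intro h
      by_contra! hc
      obtain ⟨d, hd, hsub⟩ := mem_nhdsGE_iff_exists_Ico_subset.1
        ((hrc s hs).eventually (eventually_gt_nhds hc))
      refine absurd h (not_le.2 (lt_of_lt_of_le hd (le_csInf (hne t ht) ?_)))
      rintro r ⟨hr, hrt⟩
      by_contra! hrd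
      rcases le_total s r with hsr | hsr
      · exact absurd (hsub ⟨hsr, hrd⟩) (not_lt.2 hrt)
      · exact absurd (hmono r s hr hsr) (not_le.2 (lt_of_le_of_lt hrt hc))
    · intro h
      exact csInf_le ⟨0, fun r hr => hr.1.le⟩ ⟨hs, h⟩
  have hA : ∀ c t : ℝ, 0 < c → 1 < t →
      (ENNReal.ofReal c ≤ ENNReal.ofReal (Real.log (μ t) / Real.log (1 / t)) ↔
        l (Real.exp (-c * Real.log t)) ≤ t) := by
    intro c t hc ht
    have ht0 : 0 < t := by linarith
    have hlog := Real.log_pos ht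
    rw [← hgal _ t (Real.exp_pos _) ht0, ← Real.log_le_iff_le_exp (hpos t ht0),
      ENNReal.ofReal_le_ofReal_iff', or_iff_left (not_le.2 hc), one_div, Real.log_inv,
      le_div_iff_of_neg (by linarith)]
    constructor <;> intro h <;> linarith
  have hB : ∀ c s : ℝ, 0 < c → 0 < s → s < 1 → 0 < l s →
      (ENNReal.ofReal c ≤ (ENNReal.ofReal (Real.log (l s) / Real.log (1 / s)))⁻¹ ↔
        l s ≤ Real.exp (-Real.log s / c)) := by
    intro c s hc hs hs1 hls
    have hlog := Real.log_neg hs hs1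
    rw [ENNReal.le_inv_iff_le_inv, ← ENNReal.ofReal_inv_of_pos hc,
      ENNReal.ofReal_le_ofReal_iff (by positivity), ← Real.log_le_iff_le_exp hls,
      one_div, Real.log_inv, div_le_iff₀ (by linarith), div_eq_inv_mul]
  have hs_ev : ∀ᶠ s in 𝓝[>] (0:ℝ), 0 < s ∧ s < 1 ∧ 0 < l s := by
    filter_upwards [hzero.eventually (eventually_gt_atTop 0), Ioo_mem_nhdsGT one_pos]
      with s h1 h2 using ⟨h2.1, h2.2, h1⟩
  rw [ENNReal.inv_limsup]
  apply le_antisymm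
  · apply aux_liminf_le
    intro c hc h
    have ht : Tendsto (fun s : ℝ => Real.exp (-Real.log s / c)) (𝓝[>] 0) atTop :=
      Real.tendsto_exp_atTop.comp
        ((tendsto_neg_atBot_atTop.comp Real.tendsto_log_nhdsGT_zero).atTop_div_const hc)
    filter_upwards [hs_ev, ht.eventually (h.and (eventually_gt_atTop 1))] with s hs h2
    refine (hB c s hc hs.1 hs.2.1 hs.2.2).2 ?_
    have h3 := (hA c _ hc h2.2).1 h2.1
    rw [Real.log_exp, show -c * (-Real.log s / c) = Real.log s by field_simp,
      Real.exp_log hs.1] at h3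
    exact h3
  · apply aux_liminf_le
    intro c hc h
    have ht : Tendsto (fun t : ℝ => Real.exp (-c * Real.log t)) atTop (𝓝[>] 0) :=
      Real.tendsto_exp_atBot_nhdsGT.comp
        (Real.tendsto_log_atTop.const_mul_atTop_of_neg (by linarith))
    filter_upwards [eventually_gt_atTop 1, ht.eventually (h.and hs_ev)] with t ht1 h2
    refine (hA c t hc ht1).2 ?_
    have h3 := (hB c _ hc h2.2.1 h2.2.2.1 h2.2.2.2).1 h2.1
    rw [Real.log_exp, show -(-c * Real.log t) / c = Real.log t by field_simp,
      Real.exp_log (by linarith)] at h3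
    exact h3
end

section
/- Let g : (0,∞) → (0,∞) be a measurable function which is integrable on (0,x) for every x > 0, and set G(x) = ∫_0^x g(s) ds. If liminf_{x→∞} (log g(x))/x = 0, then liminf_{x→∞} g(x)/G(x) = 0. -/
open Filter MeasureTheory Set Topology

theorem liminf_div_primitive_eq_zero
    (g G : ℝ → ℝ)
    (hmeas : Measurable g)
    (hpos : ∀ x : ℝ, 0 < x → 0 < g x)
    (hint : ∀ x : ℝ, 0 < x → IntegrableOn g (Set.Ioc 0 x) volume)
    (hG : ∀ x : ℝ, 0 < x → G x = ∫ s in Set.Ioc 0 x, g s)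
    (hord : Filter.liminf (fun x => ((Real.log (g x) / x : ℝ) : EReal)) Filter.atTop = 0) :
    Filter.liminf (fun x => ((g x / G x : ℝ) : EReal)) Filter.atTop = 0 := by
  have hsplit : ∀ x y : ℝ, 0 < x → x ≤ y → G y = G x + ∫ s in Set.Ioc x y, g s := by
    intro x y hx hxy
    rw [hG x hx, hG y (hx.trans_le hxy), ← Ioc_union_Ioc_eq_Ioc hx.le hxy]
    refine setIntegral_union (Ioc_disjoint_Ioc_of_le le_rfl) measurableSet_Ioc (hint x hx) ?_
    exact (hint y (hx.trans_le hxy)).mono_set (Ioc_subset_Ioc_left hx.le)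
  have hmono : ∀ x y : ℝ, 0 < x → x ≤ y → G x ≤ G y := by
    intro x y hx hxy
    rw [hsplit x y hx hxy]
    have : 0 ≤ ∫ s in Set.Ioc x y, g s :=
      setIntegral_nonneg measurableSet_Ioc (fun s hs => (hpos s (hx.trans hs.1)).le)
    linarith
  have hGpos : ∀ x : ℝ, 0 < x → 0 < G x := by
    intro x hx
    rw [hG x hx, setIntegral_pos_iff_support_of_nonneg_ae _ (hint x hx)]
    · have : Function.support g ∩ Ioc 0 x = Ioc 0 x :=
        inter_eq_right.2 (fun s hs => (hpos s hs.1).ne')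
      rw [this]; simp [hx]
    · filter_upwards [ae_restrict_mem measurableSet_Ioc] with s hs
      exact (hpos s hs.1).le
  have hnn : (0 : EReal) ≤ Filter.liminf (fun x => ((g x / G x : ℝ) : EReal)) Filter.atTop := by
    refine le_liminf_of_le (by isBoundedDefault) ?_
    filter_upwards [eventually_gt_atTop 0] with x hx
    exact_mod_cast (div_pos (hpos x hx) (hGpos x hx)).le
  refine (hnn.antisymm' ?_)
  by_contra hcon
  rw [not_le] at hcon
  obtain ⟨c, hc0, hc⟩ := EReal.lt_iff_exists_real_btwn.1 hcon
  have hc0 : 0 < c := by exact_mod_cast hc0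
  have hev := eventually_lt_of_lt_liminf hc
  obtain ⟨A, hA⟩ := eventually_atTop.1 (hev.and (eventually_gt_atTop 0))
  have hA0 : 0 < A := (hA A le_rfl).2
  have hgG : ∀ x, A ≤ x → c * G x ≤ g x := by
    intro x hx
    have h1 : c < g x / G x := by exact_mod_cast (hA x hx).1
    exact ((lt_div_iff₀ (hGpos x (hA0.trans_le hx))).1 h1).le
  have hstep : ∀ x, A ≤ x → (1 + c) * G x ≤ G (x + 1) := by
    intro x hx
    have hx0 := hA0.trans_le hx
    rw [hsplit x (x+1) hx0 (by linarith)]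
    have h2 : ∫ s in Set.Ioc x (x+1), (c * G x) ≤ ∫ s in Set.Ioc x (x+1), g s := by
      refine setIntegral_mono_on (integrableOn_const (by simp)) ((hint (x+1) (by linarith)).mono_set
        (Ioc_subset_Ioc_left hx0.le)) measurableSet_Ioc ?_
      intro s hs
      exact (mul_le_mul_of_nonneg_left (hmono x s hx0 hs.1.le) hc0.le).trans
        (hgG s (hx.trans hs.1.le))
    simp at h2
    linarith
  have hpow : ∀ n : ℕ, (1 + c) ^ n * G A ≤ G (A + n) := by
    intro n
    induction n with
    | zero => simp
    | succ n ih =>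
      have := hstep (A + n) (by simp)
      push_cast
      rw [← add_assoc, pow_succ]
      nlinarith
  set L := Real.log (1 + c) with hL
  have hL0 : 0 < L := Real.log_pos (by linarith)
  have hlow : ∀ x, A ≤ x → Real.log (c * G A) + L * (x - A - 1) ≤ Real.log (g x) := by
    intro x hx
    have hfl : ((⌊x - A⌋₊ : ℕ) : ℝ) ≤ x - A := Nat.floor_le (by linarith)
    have hfl2 := Nat.lt_floor_add_one (x - A)
    have h1 := hpow ⌊x - A⌋₊
    have h2 : G (A + ⌊x - A⌋₊) ≤ G x := hmono _ _ (by positivity) (by linarith)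
    have h3 := hgG x hx
    have hGA := hGpos A hA0
    have h4 : (c * G A) * (1 + c) ^ ⌊x - A⌋₊ ≤ g x := by nlinarith
    have h5 := Real.log_le_log (by positivity) h4
    rw [Real.log_mul (by positivity) (by positivity), Real.log_pow] at h5
    nlinarith
  have hge : ((L / 2 : ℝ) : EReal) ≤
      Filter.liminf (fun x => ((Real.log (g x) / x : ℝ) : EReal)) Filter.atTop := by
    refine le_liminf_of_le (by isBoundedDefault) ?_
    filter_upwards [eventually_ge_atTop A,
      eventually_ge_atTop ((L * (A + 1) - Real.log (c * G A)) / (L / 2))] with x hx hx2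
    rw [div_le_iff₀ (by positivity)] at hx2
    have := hlow x hx
    rw [EReal.coe_le_coe_iff, le_div_iff₀ (hA0.trans_le hx)]
    nlinarith
  rw [hord] at hge
  have : L / 2 ≤ 0 := by exact_mod_cast hge
  linarith
end

section
/- Let (μ_k)_{k≥1} be a nonincreasing sequence of positive real numbers with μ_k → 0, and for d > 0 set σ_n(d) = Σ_{k=1}^n μ_k^d. Then inf{ d > 0 : σ_n(d)/log n → 0 as n → ∞ } = sup{ d > 0 : the sequence (σ_n(d)/log n)_{n≥2} is unbounded }, where the equality holds in [0,∞] with the conventions inf ∅ = ∞ and sup ∅ = 0. -/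
open Filter Topology

theorem hd_aux (μ : ℕ → ℝ)
    (hpos : ∀ n : ℕ, 1 ≤ n → 0 < μ n)
    (h0 : Tendsto μ atTop (𝓝 0)) (a b C : ℝ) (hab : a < b)
    (hC : ∀ n : ℕ, 2 ≤ n → (∑ k ∈ Finset.Icc 1 n, μ k ^ a) / Real.log n ≤ C) :
    Tendsto (fun n : ℕ => (∑ k ∈ Finset.Icc 1 n, μ k ^ b) / Real.log n) atTop (𝓝 0) := by
  have hlog : Tendsto (fun n : ℕ => Real.log n) atTop atTop :=
    Real.tendsto_log_atTop.comp tendsto_natCast_atTop_atTop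
  have hp : Tendsto (fun k => μ k ^ (b - a)) atTop (𝓝 0) := by
    have := h0.rpow_const (p := b - a) (Or.inr (by linarith))
    rwa [Real.zero_rpow (by linarith)] at this
  rw [Metric.tendsto_atTop]
  intro ε hε
  set δ : ℝ := ε / (2 * (|C| + 1)) with hδ
  have hC0 : 0 < |C| + 1 := by positivity
  have hδ0 : 0 < δ := by positivity
  obtain ⟨K, hK⟩ := eventually_atTop.1 (hp.eventually (gt_mem_nhds hδ0))
  set T : ℝ := ∑ k ∈ Finset.Icc 1 K, μ k ^ b with hT
  have hbound : ∀ n : ℕ, ∑ k ∈ Finset.Icc 1 n, μ k ^ b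
      ≤ T + δ * ∑ k ∈ Finset.Icc 1 n, μ k ^ a := by
    intro n
    have h1 : ∀ k ∈ Finset.Icc 1 n, μ k ^ b ≤ (if k ≤ K then μ k ^ b else 0) + δ * μ k ^ a := by
      intro k hk
      have hk1 := hpos k (Finset.mem_Icc.1 hk).1
      have hpa : 0 < μ k ^ a := Real.rpow_pos_of_pos hk1 a
      split_ifs with h
      · nlinarith
      · have h2 := hK k (by omega)
        have h3 : μ k ^ b = μ k ^ (b - a) * μ k ^ a := by
          rw [← Real.rpow_add hk1]; ring_nf
        rw [h3]; nlinarith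
    refine (Finset.sum_le_sum h1).trans ?_
    rw [Finset.sum_add_distrib, ← Finset.mul_sum]
    gcongr
    rw [← Finset.sum_filter]
    apply Finset.sum_le_sum_of_subset_of_nonneg
    · intro k hk
      simp only [Finset.mem_filter, Finset.mem_Icc] at hk ⊢
      omega
    · intro k hk _
      exact (Real.rpow_pos_of_pos (hpos k (Finset.mem_Icc.1 hk).1) b).le
  have hTl : Tendsto (fun n : ℕ => T / Real.log n) atTop (𝓝 0) := hlog.const_div_atTop T
  obtain ⟨N, hN⟩ := eventually_atTop.1 (hTl.eventually (gt_mem_nhds (half_pos hε)))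
  refine ⟨max N 2, fun n hn => ?_⟩
  have hn2 : 2 ≤ n := le_trans (le_max_right _ _) hn
  have hnN := hN n (le_trans (le_max_left _ _) hn)
  have hl : 0 < Real.log n := Real.log_pos (by exact_mod_cast hn2)
  have hnn : 0 ≤ (∑ k ∈ Finset.Icc 1 n, μ k ^ b) / Real.log n := by
    apply div_nonneg _ hl.le
    exact Finset.sum_nonneg fun k hk =>
      (Real.rpow_pos_of_pos (hpos k (Finset.mem_Icc.1 hk).1) b).le
  rw [Real.dist_eq, sub_zero, abs_of_nonneg hnn]
  have h4 : (∑ k ∈ Finset.Icc 1 n, μ k ^ b) / Real.log n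
      ≤ T / Real.log n + δ * ((∑ k ∈ Finset.Icc 1 n, μ k ^ a) / Real.log n) := by
    rw [← mul_div_assoc, ← add_div]
    exact div_le_div_of_nonneg_right (hbound n) hl.le
  have h5 : δ * ((∑ k ∈ Finset.Icc 1 n, μ k ^ a) / Real.log n) ≤ δ * (|C| + 1) := by
    apply mul_le_mul_of_nonneg_left _ hδ0.le
    linarith [hC n hn2, le_abs_self C]
  have h6 : δ * (|C| + 1) = ε / 2 := by
    rw [hδ]; field_simp
  linarith

/-- For a nonincreasing positive null sequence `μ`, the infimum of the `d > 0` with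
`σ_n(d) = o(log n)` equals the supremum of the `d > 0` with `σ_n(d)/log n` unbounded,
in `[0,∞]` with the conventions `inf ∅ = ∞`, `sup ∅ = 0`. -/
theorem hausdorff_dimension_inf_eq_sup
    (μ : ℕ → ℝ)
    (hpos : ∀ n : ℕ, 1 ≤ n → 0 < μ n)
    (hmono : ∀ m n : ℕ, 1 ≤ m → m ≤ n → μ n ≤ μ m)
    (h0 : Tendsto μ atTop (𝓝 0)) :
    (⨅ d ∈ {d : ℝ | 0 < d ∧
        Tendsto (fun n : ℕ => (∑ k ∈ Finset.Icc 1 n, μ k ^ d) / Real.log n) atTop (𝓝 0)},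
      ENNReal.ofReal d) =
    (⨆ d ∈ {d : ℝ | 0 < d ∧
        ¬ ∃ C : ℝ, ∀ n : ℕ, 2 ≤ n → (∑ k ∈ Finset.Icc 1 n, μ k ^ d) / Real.log n ≤ C},
      ENNReal.ofReal d) := by
  have hA : ∀ a : ℝ, Tendsto (fun n : ℕ => (∑ k ∈ Finset.Icc 1 n, μ k ^ a) / Real.log n)
      atTop (𝓝 0) →
      ∃ C : ℝ, ∀ n : ℕ, 2 ≤ n → (∑ k ∈ Finset.Icc 1 n, μ k ^ a) / Real.log n ≤ C := by
    intro a ha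
    obtain ⟨C, hC⟩ := ha.bddAbove_range
    exact ⟨C, fun n _ => hC ⟨n, rfl⟩⟩
  apply le_antisymm
  · by_contra hlt
    rw [not_le] at hlt
    obtain ⟨x, hx1, hx2⟩ := ENNReal.lt_iff_exists_nnreal_btwn.1 hlt
    obtain ⟨y, hy1, hy2⟩ := ENNReal.lt_iff_exists_nnreal_btwn.1 hx2
    have hx0 : (0 : ℝ) < x := by
      have : (0 : ENNReal) < x := lt_of_le_of_lt zero_le hx1
      exact_mod_cast this
    have hxy : (x : ℝ) < y := by exact_mod_cast hy1
    have hb : ∃ C : ℝ, ∀ n : ℕ, 2 ≤ n →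
        (∑ k ∈ Finset.Icc 1 n, μ k ^ (x : ℝ)) / Real.log n ≤ C := by
      by_contra hno
      have := le_iSup₂_of_le (f := fun (d : ℝ) (_ : d ∈ {d : ℝ | 0 < d ∧
        ¬ ∃ C : ℝ, ∀ n : ℕ, 2 ≤ n → (∑ k ∈ Finset.Icc 1 n, μ k ^ d) / Real.log n ≤ C}) =>
          ENNReal.ofReal d) (x : ℝ) ⟨hx0, hno⟩ le_rfl
      rw [ENNReal.ofReal_coe_nnreal] at this
      exact absurd hx1 (not_lt.2 this)
    obtain ⟨C, hC⟩ := hb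
    have ht := hd_aux μ hpos h0 x y C hxy hC
    have := iInf₂_le_of_le (f := fun (d : ℝ) (_ : d ∈ {d : ℝ | 0 < d ∧
        Tendsto (fun n : ℕ => (∑ k ∈ Finset.Icc 1 n, μ k ^ d) / Real.log n) atTop (𝓝 0)}) =>
          ENNReal.ofReal d) (y : ℝ) ⟨hx0.trans hxy, ht⟩ le_rfl
    rw [ENNReal.ofReal_coe_nnreal] at this
    exact absurd hy2 (not_lt.2 this)
  · refine iSup₂_le fun b hb => le_iInf₂ fun a ha => ENNReal.ofReal_le_ofReal ?_
    by_contra hlt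
    rw [not_le] at hlt
    obtain ⟨C, hC⟩ := hA a ha.2
    exact hb.2 (hA b (hd_aux μ hpos h0 a b C hlt hC))
end

section
/- Let (μ_k)_{k≥1} be a nonincreasing sequence of positive real numbers with μ_k → 0, and suppose that lim_{n→∞} (log μ_n)/(log(1/n)) exists and equals 1/d for some d ∈ (0,∞). Then, setting σ_n(δ) = Σ_{k=1}^n μ_k^δ for δ > 0, one has inf{ δ > 0 : σ_n(δ)/log n → 0 as n → ∞ } = d and sup{ δ > 0 : the sequence (σ_n(δ)/log n)_{n≥2} is unbounded } = d. -/
open Filter Topology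

lemma aux_summable (μ : ℕ → ℝ) (d δ : ℝ) (hd : 0 < d) (hδ : d < δ)
    (hpos : ∀ n : ℕ, 1 ≤ n → 0 < μ n)
    (hlim : Tendsto (fun n : ℕ => Real.log (μ n) / Real.log (1 / (n : ℝ))) atTop (𝓝 (1 / d))) :
    ∃ B : ℝ, 0 ≤ B ∧ ∀ n : ℕ, (∑ k ∈ Finset.Icc 1 n, μ k ^ δ) ≤ B := by
  have hδ0 : 0 < δ := hd.trans hδ
  obtain ⟨s, hs1, hs2⟩ := exists_between (one_div_lt_one_div_of_lt hd hδ)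
  have hsδ : 1 < s * δ := by rwa [div_lt_iff₀ hδ0] at hs1
  have hsum : Summable (fun n : ℕ => (n : ℝ) ^ (-(s * δ))) :=
    Real.summable_nat_rpow.2 (by linarith)
  have hev : ∀ᶠ n : ℕ in atTop, ‖if 1 ≤ n then μ n ^ δ else 0‖ ≤ (n : ℝ) ^ (-(s * δ)) := by
    filter_upwards [hlim.eventually (lt_mem_nhds hs2), eventually_ge_atTop 2] with n hn h2
    have hp := hpos n (by omega)
    have hn1 : (1 : ℝ) < n := by exact_mod_cast h2
    have hl := Real.log_pos hn1
    rw [one_div, Real.log_inv, div_neg, lt_neg, div_lt_iff₀ hl] at hn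
    rw [if_pos (by omega), Real.norm_of_nonneg (Real.rpow_nonneg hp.le _),
      Real.rpow_def_of_pos hp, Real.rpow_def_of_pos (by linarith)]
    apply Real.exp_le_exp.2
    nlinarith
  have hS : Summable (fun n : ℕ => if 1 ≤ n then μ n ^ δ else 0) :=
    Summable.of_norm_bounded_eventually_nat hsum hev
  have hnn : ∀ n : ℕ, 0 ≤ (if 1 ≤ n then μ n ^ δ else 0) := by
    intro n
    split_ifs with h
    · exact Real.rpow_nonneg (hpos n h).le _
    · exact le_rfl
  refine ⟨∑' n : ℕ, (if 1 ≤ n then μ n ^ δ else 0), tsum_nonneg hnn, fun n => ?_⟩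
  refine le_trans (le_of_eq ?_) (hS.sum_le_tsum (Finset.Icc 1 n) (fun i _ => hnn i))
  refine Finset.sum_congr rfl fun k hk => ?_
  rw [if_pos (Finset.mem_Icc.1 hk).1]

lemma aux_atTop (μ : ℕ → ℝ) (d δ : ℝ) (hδ0 : 0 < δ) (hδ : δ < d)
    (hpos : ∀ n : ℕ, 1 ≤ n → 0 < μ n)
    (hmono : ∀ m n : ℕ, 1 ≤ m → m ≤ n → μ n ≤ μ m)
    (hlim : Tendsto (fun n : ℕ => Real.log (μ n) / Real.log (1 / (n : ℝ))) atTop (𝓝 (1 / d))) :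
    Tendsto (fun n : ℕ => (∑ k ∈ Finset.Icc 1 n, μ k ^ δ) / Real.log n) atTop atTop := by
  obtain ⟨s, hs1, hs2⟩ := exists_between (one_div_lt_one_div_of_lt hδ0 hδ)
  have hsδ : s * δ < 1 := by rwa [lt_div_iff₀ hδ0] at hs2
  obtain ⟨ε, hε⟩ : ∃ ε, ε = (1 - s * δ) / 2 := ⟨_, rfl⟩
  have hε0 : 0 < ε := by rw [hε]; linarith
  have ht : Tendsto (fun n : ℕ => ε * (n : ℝ) ^ ε) atTop atTop :=
    ((tendsto_rpow_atTop hε0).comp tendsto_natCast_atTop_atTop).const_mul_atTop hε0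
  refine tendsto_atTop_mono' _ ?_ ht
  filter_upwards [hlim.eventually (gt_mem_nhds hs1), eventually_ge_atTop 2] with n hn h2
  have hp := hpos n (by omega)
  have hn1 : (1 : ℝ) < n := by exact_mod_cast h2
  have hn0 : (0 : ℝ) < n := by linarith
  have hl := Real.log_pos hn1
  rw [one_div, Real.log_inv, div_neg, neg_lt, lt_div_iff₀ hl] at hn
  have h1 : (n : ℝ) ^ (-(s * δ)) ≤ μ n ^ δ := by
    rw [Real.rpow_def_of_pos hp, Real.rpow_def_of_pos hn0]
    apply Real.exp_le_exp.2
    nlinarith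
  have h3 : (n : ℝ) * μ n ^ δ ≤ ∑ k ∈ Finset.Icc 1 n, μ k ^ δ := by
    have := Finset.card_nsmul_le_sum (Finset.Icc 1 n) (fun k => μ k ^ δ) (μ n ^ δ) (by
      intro k hk
      have hk := Finset.mem_Icc.1 hk
      exact Real.rpow_le_rpow hp.le (hmono k n hk.1 hk.2) hδ0.le)
    simpa using this
  have h4 : (n : ℝ) ^ ε * (n : ℝ) ^ ε = n * (n : ℝ) ^ (-(s * δ)) := by
    rw [← Real.rpow_add hn0, ← Real.rpow_one_add' hn0.le (by linarith)]
    congr 1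
    rw [hε]; ring
  have h5 := Real.log_le_rpow_div hn0.le hε0
  rw [le_div_iff₀ hε0] at h5
  have h6 : 0 < (n : ℝ) ^ ε := Real.rpow_pos_of_pos hn0 _
  rw [le_div_iff₀ hl]
  nlinarith [mul_le_mul_of_nonneg_left h5 h6.le, mul_le_mul_of_nonneg_left h1 hn0.le]

/-- If the polynomial order `lim (log μ_n)/(log(1/n))` of the singular value sequence
exists and equals `1/d`, then the box dimension `d` coincides with the Hausdorff
dimension, both as infimum and as supremum. -/
theorem box_dim_eq_hausdorff_dim_of_lim_exists
    (μ : ℕ → ℝ) (d : ℝ) (hd : 0 < d)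
    (hpos : ∀ n : ℕ, 1 ≤ n → 0 < μ n)
    (hmono : ∀ m n : ℕ, 1 ≤ m → m ≤ n → μ n ≤ μ m)
    (h0 : Tendsto μ atTop (𝓝 0))
    (hlim : Tendsto (fun n : ℕ => Real.log (μ n) / Real.log (1 / (n : ℝ))) atTop (𝓝 (1 / d))) :
    sInf {δ : ℝ | 0 < δ ∧
        Tendsto (fun n : ℕ => (∑ k ∈ Finset.Icc 1 n, μ k ^ δ) / Real.log n) atTop (𝓝 0)} = d ∧
    sSup {δ : ℝ | 0 < δ ∧
        ¬ ∃ C : ℝ, ∀ n : ℕ, 2 ≤ n → (∑ k ∈ Finset.Icc 1 n, μ k ^ δ) / Real.log n ≤ C} = d := by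
  have hA : ∀ δ, d < δ → Tendsto (fun n : ℕ => (∑ k ∈ Finset.Icc 1 n, μ k ^ δ) / Real.log n)
      atTop (𝓝 0) := by
    intro δ hδ
    obtain ⟨B, hB0, hB⟩ := aux_summable μ d δ hd hδ hpos hlim
    have hlog : Tendsto (fun n : ℕ => Real.log n) atTop atTop :=
      Real.tendsto_log_atTop.comp tendsto_natCast_atTop_atTop
    refine squeeze_zero' ?_ ?_ (hlog.const_div_atTop B)
    · refine Eventually.of_forall fun n => div_nonneg (Finset.sum_nonneg fun k hk => ?_)
        (Real.log_natCast_nonneg n)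
      exact Real.rpow_nonneg (hpos k (Finset.mem_Icc.1 hk).1).le _
    · exact Eventually.of_forall fun n =>
        div_le_div_of_nonneg_right (hB n) (Real.log_natCast_nonneg n)
  have hA' : ∀ δ, d < δ → ∃ C : ℝ, ∀ n : ℕ, 2 ≤ n →
      (∑ k ∈ Finset.Icc 1 n, μ k ^ δ) / Real.log n ≤ C := by
    intro δ hδ
    obtain ⟨B, hB0, hB⟩ := aux_summable μ d δ hd hδ hpos hlim
    refine ⟨B / Real.log 2, fun n hn => ?_⟩
    exact div_le_div₀ hB0 (hB n) (Real.log_pos (by norm_num))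
      (Real.log_le_log (by norm_num) (by exact_mod_cast hn))
  have hB : ∀ δ, 0 < δ → δ < d → Tendsto (fun n : ℕ =>
      (∑ k ∈ Finset.Icc 1 n, μ k ^ δ) / Real.log n) atTop atTop :=
    fun δ h1 h2 => aux_atTop μ d δ h1 h2 hpos hmono hlim
  constructor
  · apply csInf_eq_of_forall_ge_of_forall_gt_exists_lt
    · exact ⟨d + 1, by linarith, hA _ (by linarith)⟩
    · rintro δ ⟨h1, h2⟩
      by_contra! h
      exact not_tendsto_nhds_of_tendsto_atTop (hB δ h1 h) _ h2
    · intro w hw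
      obtain ⟨δ, h1, h2⟩ := exists_between hw
      exact ⟨δ, ⟨hd.trans h1, hA δ h1⟩, h2⟩
  · have hmem : ∀ δ, 0 < δ → δ < d → ¬ ∃ C : ℝ, ∀ n : ℕ, 2 ≤ n →
        (∑ k ∈ Finset.Icc 1 n, μ k ^ δ) / Real.log n ≤ C := by
      rintro δ h1 h2 ⟨C, hC⟩
      obtain ⟨n, hn, hn2⟩ :=
        (((hB δ h1 h2).eventually_gt_atTop C).and (eventually_ge_atTop 2)).exists
      exact absurd (hC n hn2) (not_le.2 hn)
    apply csSup_eq_of_forall_le_of_forall_lt_exists_gt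
    · exact ⟨d / 2, by linarith, hmem _ (by linarith) (by linarith)⟩
    · rintro δ ⟨h1, h2⟩
      by_contra! h
      exact h2 (hA' δ h)
    · intro w hw
      obtain ⟨δ, h1, h2⟩ := exists_between (max_lt hw hd)
      have h3 := (le_max_right w 0).trans_lt h1
      exact ⟨δ, ⟨h3, hmem δ h3 h2⟩, (le_max_left w 0).trans_lt h1⟩
end

section
/- Let (μ_n)_{n≥1} be a nonincreasing sequence of positive real numbers such that lim_{n→∞} μ_{2n}/μ_n exists and equals L ∈ (0,1]. Then lim_{n→∞} (log μ_n)/(log(1/n)) exists and equals log(1/L)/log 2. -/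
open Filter Topology

lemma aux_log_div (μ : ℕ → ℝ) (L : ℝ)
    (hpos : ∀ n : ℕ, 1 ≤ n → 0 < μ n)
    (hmono : ∀ m n : ℕ, 1 ≤ m → m ≤ n → μ n ≤ μ m)
    (hL : 0 < L)
    (hlim : Tendsto (fun n : ℕ => μ (2 * n) / μ n) atTop (𝓝 L)) :
    Tendsto (fun n : ℕ => Real.log (μ n) / (Nat.log 2 n : ℝ)) atTop (𝓝 (Real.log L)) := by
  have h2 : Tendsto (fun k : ℕ => 2 ^ k) atTop (atTop : Filter ℕ) :=
    tendsto_pow_atTop_atTop_of_one_lt (by norm_num)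
  have hd : Tendsto (fun k : ℕ => Real.log (μ (2 ^ (k+1))) - Real.log (μ (2 ^ k))) atTop
      (𝓝 (Real.log L)) := by
    have h := ((Real.continuousAt_log hL.ne').tendsto.comp hlim).comp h2
    refine h.congr fun k => ?_
    simp only [Function.comp]
    rw [Real.log_div (hpos _ (by have := Nat.one_le_two_pow (n := k); omega)).ne'
      (hpos _ Nat.one_le_two_pow).ne', pow_succ, mul_comm]
  have hc := hd.cesaro
  have hinv : Tendsto (fun k : ℕ => ((k : ℝ))⁻¹) atTop (𝓝 0) := tendsto_inv_atTop_nhds_zero_nat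
  have ha : Tendsto (fun k : ℕ => Real.log (μ (2 ^ k)) / (k : ℝ)) atTop (𝓝 (Real.log L)) := by
    have h := hc.add (hinv.mul_const (Real.log (μ (2 ^ 0))))
    rw [zero_mul, add_zero] at h
    refine h.congr fun k => ?_
    rw [Finset.sum_range_sub (fun k => Real.log (μ (2 ^ k)))]
    ring
  have hb : Tendsto (fun k : ℕ => Real.log (μ (2 ^ (k + 1))) / (k : ℝ)) atTop
      (𝓝 (Real.log L)) := by
    have h := ha.add (hinv.mul hd)
    rw [zero_mul, add_zero] at h
    refine h.congr fun k => ?_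
    ring
  have hk : Tendsto (fun n : ℕ => Nat.log 2 n) atTop atTop := by
    refine tendsto_atTop.2 fun b => ?_
    filter_upwards [eventually_ge_atTop (2 ^ b)] with n hn
    exact Nat.le_log_of_pow_le (by norm_num) hn
  refine tendsto_of_tendsto_of_tendsto_of_le_of_le' (hb.comp hk) (ha.comp hk) ?_ ?_
  · filter_upwards [eventually_ge_atTop 1] with n hn
    simp only [Function.comp]
    gcongr
    · exact hpos _ Nat.one_le_two_pow
    · exact hmono _ _ hn (Nat.lt_pow_succ_log_self (by norm_num) n).le
  · filter_upwards [eventually_ge_atTop 1] with n hn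
    simp only [Function.comp]
    gcongr
    · exact hpos _ hn
    · exact hmono _ _ Nat.one_le_two_pow (Nat.pow_log_le_self 2 (by omega))

theorem polynomial_order_of_dyadic_ratio
    (μ : ℕ → ℝ) (L : ℝ)
    (hpos : ∀ n : ℕ, 1 ≤ n → 0 < μ n)
    (hmono : ∀ m n : ℕ, 1 ≤ m → m ≤ n → μ n ≤ μ m)
    (hL : L ∈ Set.Ioc (0:ℝ) 1)
    (hlim : Tendsto (fun n : ℕ => μ (2 * n) / μ n) atTop (𝓝 L)) :
    Tendsto (fun n : ℕ => Real.log (μ n) / Real.log (1 / (n : ℝ))) atTop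
      (𝓝 (Real.log (1 / L) / Real.log 2)) := by
  have h1 := aux_log_div μ L hpos hmono hL.1 hlim
  have h2 := aux_log_div (fun n => 1 / (n : ℝ)) (1 / 2)
    (fun n hn => by positivity)
    (fun m n hm hmn => by
      have : (0:ℝ) < m := by exact_mod_cast hm
      gcongr)
    (by norm_num)
    (by
      refine tendsto_const_nhds.congr' ?_
      filter_upwards [eventually_ge_atTop 1] with n hn
      have : (0:ℝ) < n := by exact_mod_cast hn
      push_cast
      field_simp)
  have h2' : Real.log (1 / 2) ≠ 0 := by
    rw [one_div, Real.log_inv]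
    exact neg_ne_zero.2 (Real.log_pos (by norm_num)).ne'
  have h := h1.div h2 h2'
  have e : Real.log (1 / L) / Real.log 2 = Real.log L / Real.log (1 / 2) := by
    rw [one_div, one_div, Real.log_inv, Real.log_inv, neg_div, div_neg]
  rw [e]
  refine h.congr' ?_
  filter_upwards [eventually_ge_atTop 2] with n hn
  have : (Nat.log 2 n : ℝ) ≠ 0 := by
    exact_mod_cast (Nat.log_pos (by norm_num) hn).ne'
  exact div_div_div_cancel_right₀ this _ _
end

section
/- Let (ν_n)_{n≥1} be a nonincreasing sequence of positive real numbers with Σ_{n=1}^∞ ν_n = ∞, and suppose that lim_{n→∞} ν_{2n}/ν_n exists and equals c ∈ (0,1]. Then, setting s_n = Σ_{k=1}^n ν_k, one has lim_{n→∞} s_{2n}/s_n = 2c. -/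
open Filter Topology

theorem partial_sum_dyadic_ratio_of_dyadic_ratio
    (ν : ℕ → ℝ) (c : ℝ)
    (hpos : ∀ n : ℕ, 1 ≤ n → 0 < ν n)
    (hmono : ∀ m n : ℕ, 1 ≤ m → m ≤ n → ν n ≤ ν m)
    (hc : c ∈ Set.Ioc (0:ℝ) 1)
    (hdiv : Tendsto (fun n : ℕ => ∑ k ∈ Finset.Icc 1 n, ν k) atTop atTop)
    (hlim : Tendsto (fun n : ℕ => ν (2 * n) / ν n) atTop (𝓝 c)) :
    Tendsto (fun n : ℕ =>
        (∑ k ∈ Finset.Icc 1 (2 * n), ν k) / (∑ k ∈ Finset.Icc 1 n, ν k)) atTop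
      (𝓝 (2 * c)) := by
  have hS : ∀ n : ℕ, ∑ k ∈ Finset.Icc 1 n, ν k = ∑ k ∈ Finset.range n, ν (k + 1) := by
    intro n
    induction n with
    | zero => simp
    | succ n ih => rw [Finset.sum_Icc_succ_top (by omega), Finset.sum_range_succ, ih]
  simp only [hS] at hdiv ⊢
  have hb : ∀ n : ℕ, 2 * ∑ k ∈ Finset.range n, ν (2 * (k + 1)) ≤
        ∑ k ∈ Finset.range (2 * n), ν (k + 1) ∧
      ∑ k ∈ Finset.range (2 * n), ν (k + 1) + ν (2 * n + 1) ≤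
        2 * ∑ k ∈ Finset.range n, ν (2 * (k + 1)) + ν 1 := by
    intro n
    induction n with
    | zero => simp
    | succ n ih =>
      have e : 2 * (n + 1) = 2 * n + 1 + 1 := by ring
      have h1 := hmono (2 * n + 1) (2 * n + 1 + 1) (by omega) (by omega)
      have h2 := hmono (2 * n + 1 + 1) (2 * n + 1 + 1 + 1) (by omega) (by omega)
      rw [Finset.sum_range_succ (fun k => ν (2 * (k + 1))), e, Finset.sum_range_succ,
        Finset.sum_range_succ]
      constructor <;> linarith [ih.1, ih.2]
  have ho : (fun k : ℕ => ν (2 * (k + 1)) - c * ν (k + 1)) =o[atTop] (fun k => ν (k + 1)) := by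
    rw [Asymptotics.isLittleO_iff_tendsto (fun k hk => absurd hk (hpos _ (by omega)).ne')]
    have h := ((tendsto_add_atTop_iff_nat 1).2 hlim).sub_const c
    rw [sub_self] at h
    refine h.congr fun k => ?_
    have := (hpos (k + 1) (by omega)).ne'
    field_simp
  have hs := (ho.sum_range (fun k => (hpos (k + 1) (by omega)).le) hdiv).tendsto_div_nhds_zero
  have hr : Tendsto (fun n : ℕ => (∑ k ∈ Finset.range (2 * n), ν (k + 1) -
      2 * ∑ k ∈ Finset.range n, ν (2 * (k + 1))) / ∑ k ∈ Finset.range n, ν (k + 1))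
      atTop (𝓝 0) := by
    refine squeeze_zero' ?_ ?_ (hdiv.const_div_atTop (ν 1))
    · filter_upwards [hdiv.eventually_gt_atTop 0] with n hn
      exact div_nonneg (by linarith [(hb n).1]) hn.le
    · filter_upwards [hdiv.eventually_gt_atTop 0] with n hn
      have := hpos (2 * n + 1) (by omega)
      exact div_le_div_of_nonneg_right (by linarith [(hb n).2]) hn.le
  have h := ((hs.const_mul 2).add hr).add_const (2 * c)
  simp only [mul_zero, zero_add] at h
  refine h.congr' ?_
  filter_upwards [hdiv.eventually_gt_atTop 0] with n hn
  rw [Finset.sum_sub_distrib, ← Finset.mul_sum]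
  field_simp
  ring
end

section
/- Let (μ_n)_{n≥1} be a nonincreasing sequence of positive real numbers with μ_n → 0, such that lim_{n→∞} μ_{2n}/μ_n exists and equals L ∈ (0,1), and set d_B = log 2 / log(1/L). For d > 0 define s_n(d) = Σ_{k=1}^n μ_k^d if Σ_{k=1}^∞ μ_k^d = ∞, and s_n(d) = Σ_{k=n}^∞ μ_k^d otherwise. Then 1 is a limit point of the sequence (s_{2n}(d)/s_n(d))_{n≥1} if and only if d = d_B. -/
open Filter Topology

namespace EccAux

/-- Tail sums. -/
noncomputable def T (a : ℕ → ℝ) (n : ℕ) : ℝ := ∑' k, a (k + n)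

/-- Partial sums. -/
noncomputable def S (a : ℕ → ℝ) (n : ℕ) : ℝ := ∑ k ∈ Finset.range n, a (k + 1)

lemma S_succ (a : ℕ → ℝ) (n : ℕ) : S a (n + 1) = S a n + a (n + 1) :=
  Finset.sum_range_succ _ _

lemma T_succ {a : ℕ → ℝ} (hs : Summable a) (n : ℕ) : T a n = a n + T a (n + 1) := by
  unfold T
  rw [((summable_nat_add_iff n).2 hs).tsum_eq_zero_add]
  simp only [zero_add]
  congr 2
  ext k
  congr 1
  ring

lemma T_even {a : ℕ → ℝ} (hs : Summable a) (n : ℕ) :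
    Summable (fun k => a (2 * (k + n))) ∧ Summable (fun k => a (2 * (k + n) + 1)) ∧
    T a (2 * n) = (∑' k, a (2 * (k + n))) + ∑' k, a (2 * (k + n) + 1) := by
  have h1 : Summable (fun k => a (2 * (k + n))) :=
    hs.comp_injective (i := fun k => 2 * (k + n)) (fun x y h => by simp at h; omega)
  have h2 : Summable (fun k => a (2 * (k + n) + 1)) :=
    hs.comp_injective (i := fun k => 2 * (k + n) + 1) (fun x y h => by simp at h; omega)
  refine ⟨h1, h2, ?_⟩
  have e1 : ∀ k, a (2 * (k + n)) = a (2 * k + 2 * n) := fun k => by rw [mul_add]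
  have e2 : ∀ k, a (2 * (k + n) + 1) = a (2 * k + 1 + 2 * n) := fun k => by
    rw [mul_add, add_right_comm]
  simp only [e1] at h1 ⊢
  simp only [e2] at h2 ⊢
  unfold T
  generalize 2 * n = m at *
  have h := tsum_even_add_odd (f := fun j => a (j + m)) h1 h2
  exact h.symm

lemma T_upper {a : ℕ → ℝ} (hs : Summable a)
    (hm : ∀ m n : ℕ, 1 ≤ m → m ≤ n → a n ≤ a m) (c : ℝ) (n : ℕ) (hn : 1 ≤ n)
    (h : ∀ k, n ≤ k → a (2 * k) ≤ c * a k) : T a (2 * n) ≤ 2 * c * T a n := by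
  obtain ⟨h1, h2, h3⟩ := T_even hs n
  have hs' : Summable (fun k => c * a (k + n)) := ((summable_nat_add_iff n).2 hs).mul_left c
  have h4 : ∑' k, a (2 * (k + n)) ≤ ∑' k, c * a (k + n) :=
    h1.tsum_le_tsum (fun k => h _ (by omega)) hs'
  have h5 : ∑' k, a (2 * (k + n) + 1) ≤ ∑' k, c * a (k + n) :=
    h2.tsum_le_tsum (fun k => (hm (2 * (k + n)) _ (by omega) (by omega)).trans
      (h _ (by omega))) hs'
  rw [tsum_mul_left] at h4 h5
  rw [h3]; unfold T; linarith

lemma T_lower {a : ℕ → ℝ} (hs : Summable a)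
    (hm : ∀ m n : ℕ, 1 ≤ m → m ≤ n → a n ≤ a m) (c : ℝ) (n : ℕ) (hn : 1 ≤ n)
    (h : ∀ k, n ≤ k → c * a k ≤ a (2 * k)) : 2 * c * T a (n + 1) ≤ T a (2 * n) := by
  obtain ⟨h1, h2, h3⟩ := T_even hs n
  have hs' : Summable (fun k => c * a (k + (n + 1))) :=
    ((summable_nat_add_iff (n + 1)).2 hs).mul_left c
  have h4 : ∑' k, c * a (k + (n + 1)) ≤ ∑' k, a (2 * (k + n)) :=
    hs'.tsum_le_tsum (fun k => (h _ (by omega)).trans (hm _ _ (by omega) (by omega))) h1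
  have h5 : ∑' k, c * a (k + (n + 1)) ≤ ∑' k, a (2 * (k + n) + 1) :=
    hs'.tsum_le_tsum (fun k => (h _ (by omega)).trans (hm _ _ (by omega) (by omega))) h2
  rw [tsum_mul_left] at h4 h5
  rw [h3]; unfold T; linarith

lemma T_pos {a : ℕ → ℝ} (hs : Summable a) (hp : ∀ n, 1 ≤ n → 0 < a n) (n : ℕ) (hn : 1 ≤ n) :
    0 < T a n :=
  ((summable_nat_add_iff n).2 hs).tsum_pos (fun k => (hp _ (by omega)).le) 0 (hp _ (by omega))

lemma T_anti {a : ℕ → ℝ} (hs : Summable a) (hp : ∀ n, 1 ≤ n → 0 < a n) (m n : ℕ) (hn : 1 ≤ m)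
    (hmn : m ≤ n) : T a n ≤ T a m := by
  induction n, hmn using Nat.le_induction with
  | base => exact le_rfl
  | succ k hk ih =>
    have := T_succ hs k
    have := hp k (by omega)
    linarith

/-- `T n ≥ n * a (2 n)`. -/
lemma T_ge {a : ℕ → ℝ} (hs : Summable a) (hp : ∀ n, 1 ≤ n → 0 < a n)
    (hm : ∀ m n : ℕ, 1 ≤ m → m ≤ n → a n ≤ a m) (n : ℕ) (hn : 1 ≤ n) :
    n * a (2 * n) ≤ T a n := by
  have h := ((summable_nat_add_iff n).2 hs).sum_le_tsum (Finset.range n)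
    (fun k _ => (hp (k + n) (by omega)).le)
  refine le_trans ?_ h
  have := Finset.card_nsmul_le_sum (Finset.range n) (fun k => a (k + n)) (a (2 * n))
    (fun k hk => hm _ _ (by omega) (by have := Finset.mem_range.1 hk; omega))
  simpa using this

lemma S_lower {a : ℕ → ℝ}
    (hm : ∀ m n : ℕ, 1 ≤ m → m ≤ n → a n ≤ a m) (c : ℝ) (N : ℕ)
    (h : ∀ k, N ≤ k → c * a k ≤ a (2 * k)) :
    ∃ K, ∀ n, N ≤ n → K + 2 * c * S a n ≤ S a (2 * n) := by
  refine ⟨S a (2 * N) - 2 * c * S a N, fun n hn => ?_⟩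
  induction n, hn using Nat.le_induction with
  | base => linarith
  | succ k hk ih =>
    have e : 2 * (k + 1) = 2 * k + 1 + 1 := by ring
    have h1 := h (k + 1) (by omega)
    have h2 := hm (2 * k + 1) (2 * k + 1 + 1) (by omega) (by omega)
    rw [e] at h1 ⊢
    rw [S_succ, S_succ, S_succ]
    linarith

lemma S_upper {a : ℕ → ℝ}
    (hm : ∀ m n : ℕ, 1 ≤ m → m ≤ n → a n ≤ a m) (c : ℝ) (N : ℕ)
    (h : ∀ k, N ≤ k → a (2 * k) ≤ c * a k) :
    ∃ K, ∀ n, N ≤ n → S a (2 * n + 1) ≤ K + 2 * c * S a n := by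
  refine ⟨S a (2 * N + 1) - 2 * c * S a N, fun n hn => ?_⟩
  induction n, hn using Nat.le_induction with
  | base => linarith
  | succ k hk ih =>
    have e : 2 * (k + 1) = 2 * k + 1 + 1 := by ring
    have h1 := h (k + 1) (by omega)
    have h2 := hm (2 * k + 1 + 1) (2 * k + 1 + 1 + 1) (by omega) (by omega)
    rw [e] at h1 ⊢
    rw [S_succ a (2 * k + 1 + 1), S_succ a (2 * k + 1), S_succ a k]
    linarith

lemma S_mono {a : ℕ → ℝ} (hp : ∀ n, 1 ≤ n → 0 < a n) : Monotone (S a) :=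
  monotone_nat_of_le_succ fun n => by
    rw [S_succ]; linarith [hp (n + 1) (by omega)]

lemma S_tendsto {a : ℕ → ℝ} (hp : ∀ n, 1 ≤ n → 0 < a n) (hs : ¬ Summable a) :
    Tendsto (S a) atTop atTop :=
  (not_summable_iff_tendsto_nat_atTop_of_nonneg (f := fun k => a (k + 1))
    (fun n => (hp (n + 1) (by omega)).le)).1 (fun h => hs ((summable_nat_add_iff 1).1 h))

lemma ev_upper {a : ℕ → ℝ} (hp : ∀ n, 1 ≤ n → 0 < a n) {q c : ℝ} (hc : q < c)
    (hq : Tendsto (fun n : ℕ => a (2 * n) / a n) atTop (𝓝 q)) :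
    ∃ N, 1 ≤ N ∧ ∀ k, N ≤ k → a (2 * k) ≤ c * a k := by
  obtain ⟨N, hN⟩ := eventually_atTop.1 (hq.eventually_lt_const hc)
  refine ⟨N + 1, by omega, fun k hk => ?_⟩
  exact (div_le_iff₀ (hp k (by omega))).1 (hN k (by omega)).le

lemma ev_lower {a : ℕ → ℝ} (hp : ∀ n, 1 ≤ n → 0 < a n) {q c : ℝ} (hc : c < q)
    (hq : Tendsto (fun n : ℕ => a (2 * n) / a n) atTop (𝓝 q)) :
    ∃ N, 1 ≤ N ∧ ∀ k, N ≤ k → c * a k ≤ a (2 * k) := by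
  obtain ⟨N, hN⟩ := eventually_atTop.1 (hq.eventually_const_lt hc)
  refine ⟨N + 1, by omega, fun k hk => ?_⟩
  exact (le_div_iff₀ (hp k (by omega))).1 (hN k (by omega)).le

lemma not_cluster_lt {u : ℕ → ℝ} {c : ℝ} (hc : c < 1) (h : ∀ᶠ n in atTop, u n ≤ c) :
    ¬ MapClusterPt (1 : ℝ) atTop u := by
  intro hcl
  obtain ⟨n, h1, h2⟩ := ((mapClusterPt_iff_frequently.1 hcl _ (Ioi_mem_nhds hc)).and_eventually
    h).exists
  exact absurd h2 (not_le.2 h1)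

lemma not_cluster_gt {u : ℕ → ℝ} {c : ℝ} (hc : 1 < c) (h : ∀ᶠ n in atTop, c ≤ u n) :
    ¬ MapClusterPt (1 : ℝ) atTop u := by
  intro hcl
  obtain ⟨n, h1, h2⟩ := ((mapClusterPt_iff_frequently.1 hcl _ (Iio_mem_nhds hc)).and_eventually
    h).exists
  exact absurd h2 (not_le.2 h1)

lemma case_summable {a : ℕ → ℝ} (hp : ∀ n, 1 ≤ n → 0 < a n)
    (hm : ∀ m n : ℕ, 1 ≤ m → m ≤ n → a n ≤ a m) {q : ℝ} (hq0 : 0 < q)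
    (hq : Tendsto (fun n : ℕ => a (2 * n) / a n) atTop (𝓝 q)) (hs : Summable a) :
    MapClusterPt (1 : ℝ) atTop (fun n => T a (2 * n) / T a n) ↔ 2 * q = 1 := by
  rcases lt_trichotomy (2 * q) 1 with h | h | h
  · refine iff_of_false ?_ h.ne
    obtain ⟨c, hc1, hc2⟩ := exists_between (show q < 1 / 2 by linarith)
    obtain ⟨N, hN1, hN⟩ := ev_upper hp hc1 hq
    refine not_cluster_lt (c := 2 * c) (by linarith) ?_
    filter_upwards [eventually_ge_atTop N] with n hn
    rw [div_le_iff₀ (T_pos hs hp n (by omega))]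
    exact T_upper hs hm c n (by omega) (fun k hk => hN k (by omega))
  · refine iff_of_true ?_ h
    refine Tendsto.mapClusterPt ?_
    rw [tendsto_order]
    constructor
    · intro b hb
      -- choose c with b' < 2c < 1
      obtain ⟨c, hc1, hc2⟩ := exists_between (show max (b / 2) (q / 2) < q by
        rw [max_lt_iff]; constructor <;> linarith)
      rw [max_lt_iff] at hc1
      obtain ⟨N, hN1, hN⟩ := ev_lower hp hc2 hq
      have hc0 : 0 < c := by linarith
      have hlim : Tendsto (fun n : ℕ => 2 * c - 2 / (n : ℝ)) atTop (𝓝 (2 * c - 0)) :=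
        tendsto_const_nhds.sub (tendsto_const_div_atTop_nhds_zero_nat 2)
      filter_upwards [eventually_ge_atTop N, hlim.eventually_const_lt
        (show b < 2 * c - 0 by linarith)] with n hn hb'
      have hTp := T_pos hs hp n (by omega)
      rw [lt_div_iff₀ hTp]
      have hn0 : (0 : ℝ) < n := by exact_mod_cast (by omega : 0 < n)
      have h1 := T_lower hs hm c n (by omega) (fun k hk => hN k (by omega))
      have h2 := T_succ hs n
      have h3 := T_ge hs hp hm n (by omega)
      have h4 := hN n hn
      have h5 : c * a n ≤ T a n / n := by
        rw [le_div_iff₀ hn0]; nlinarith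
      have h6 : b * T a n < (2 * c - 2 / n) * T a n := mul_lt_mul_of_pos_right hb' hTp
      have h7 : (2 * c - 2 / n) * T a n = 2 * c * T a n - 2 * (T a n / n) := by ring
      nlinarith
    · intro b hb
      filter_upwards [eventually_ge_atTop 1] with n hn
      refine lt_of_le_of_lt ?_ hb
      rw [div_le_one (T_pos hs hp n hn)]
      exact T_anti hs hp _ _ hn (by omega)
  · exfalso
    obtain ⟨c, hc1, hc2⟩ := exists_between (show 1 / 2 < q by linarith)
    obtain ⟨N, hN1, hN⟩ := ev_lower hp hc2 hq
    have h1 := T_lower hs hm c N hN1 hN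
    have h2 := T_anti hs hp (N + 1) (2 * N) (by omega) (by omega)
    have h3 := T_pos hs hp (N + 1) (by omega)
    nlinarith

lemma case_not_summable {a : ℕ → ℝ} (hp : ∀ n, 1 ≤ n → 0 < a n)
    (hm : ∀ m n : ℕ, 1 ≤ m → m ≤ n → a n ≤ a m) {q : ℝ}
    (hq : Tendsto (fun n : ℕ => a (2 * n) / a n) atTop (𝓝 q)) (hs : ¬ Summable a) :
    MapClusterPt (1 : ℝ) atTop (fun n => S a (2 * n) / S a n) ↔ 2 * q = 1 := by
  have hS := S_tendsto hp hs
  have hK : ∀ K c : ℝ, Tendsto (fun n => K / S a n + 2 * c) atTop (𝓝 (0 + 2 * c)) :=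
    fun K c => (hS.const_div_atTop K).add tendsto_const_nhds
  rcases lt_trichotomy (2 * q) 1 with h | h | h
  · exfalso
    obtain ⟨c, hc1, hc2⟩ := exists_between (show q < 1 / 2 by linarith)
    obtain ⟨N, hN1, hN⟩ := ev_upper hp hc1 hq
    obtain ⟨K, hKK⟩ := S_upper hm c N hN
    obtain ⟨n, hn, h1, h2⟩ := ((eventually_ge_atTop N).and
      (((hK K c).eventually_lt_const (show 0 + 2 * c < 1 by linarith)).and
        (hS.eventually_gt_atTop 0))).exists
    have h3 := hKK n hn
    have h4 := S_mono hp (show n ≤ 2 * n + 1 by omega)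
    have h5 : (K / S a n + 2 * c) * S a n = K + 2 * c * S a n := by field_simp
    nlinarith
  · refine iff_of_true ?_ h
    refine Tendsto.mapClusterPt ?_
    rw [tendsto_order]
    constructor
    · intro b hb
      filter_upwards [hS.eventually_gt_atTop 0] with n hn
      refine lt_of_lt_of_le hb ?_
      rw [one_le_div hn]
      exact S_mono hp (by omega)
    · intro b hb
      obtain ⟨c, hc1, hc2⟩ := exists_between (show q < b / 2 by linarith)
      obtain ⟨N, hN1, hN⟩ := ev_upper hp hc1 hq
      obtain ⟨K, hKK⟩ := S_upper hm c N hN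
      filter_upwards [eventually_ge_atTop N, (hK K c).eventually_lt_const
        (show 0 + 2 * c < b by linarith), hS.eventually_gt_atTop 0] with n hn h1 h2
      refine lt_of_le_of_lt ?_ h1
      rw [div_le_iff₀ h2]
      have h5 : (K / S a n + 2 * c) * S a n = K + 2 * c * S a n := by field_simp
      rw [h5]
      exact (S_mono hp (by omega)).trans (hKK n hn)
  · refine iff_of_false ?_ h.ne'
    obtain ⟨c, hc1, hc2⟩ := exists_between (show 1 / 2 < q by linarith)
    obtain ⟨N, hN1, hN⟩ := ev_lower hp hc2 hq
    obtain ⟨K, hKK⟩ := S_lower hm c N hN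
    obtain ⟨e, he1, he2⟩ := exists_between (show 1 < 0 + 2 * c by linarith)
    refine not_cluster_gt he1 ?_
    filter_upwards [eventually_ge_atTop N, (hK K c).eventually_const_lt he2,
      hS.eventually_gt_atTop 0] with n hn h1 h2
    refine h1.le.trans ?_
    rw [le_div_iff₀ h2]
    have h5 : (K / S a n + 2 * c) * S a n = K + 2 * c * S a n := by field_simp
    rw [h5]
    exact hKK n hn

lemma tsum_ite_eq_T {a : ℕ → ℝ} (hs : Summable a) (n : ℕ) :
    (∑' k : ℕ, if n ≤ k then a k else 0) = T a n := by
  have e : (fun k => if n ≤ k + n then a (k + n) else 0) = fun k => a (k + n) := by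
    ext k; simp
  have hs' : Summable (fun k : ℕ => if n ≤ k then a k else 0) := by
    rw [← summable_nat_add_iff n, e]
    exact (summable_nat_add_iff n).2 hs
  rw [← hs'.sum_add_tsum_nat_add n, e, Finset.sum_eq_zero, zero_add]
  · rfl
  · intro k hk
    rw [if_neg (by have := Finset.mem_range.1 hk; omega)]

lemma sum_Icc_eq_S (a : ℕ → ℝ) (n : ℕ) : ∑ k ∈ Finset.Icc 1 n, a k = S a n := by
  induction n with
  | zero => simp [S]
  | succ n ih => rw [Finset.sum_Icc_succ_top (by omega), ih, S_succ]

end EccAux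

/-- Under the dyadic ratio regularity hypothesis, the box dimension
`d_B = log 2 / log (1/L)` is the unique exponent `d > 0` such that `(μ_n^d)` is
`∞`-eccentric, i.e. such that `1` is a limit point of `s_{2n}(d)/s_n(d)`. -/
theorem eccentric_iff_eq_box_dim
    (μ : ℕ → ℝ) (L : ℝ) (s : ℝ → ℕ → ℝ) (d : ℝ) (hd : 0 < d)
    (hpos : ∀ n : ℕ, 1 ≤ n → 0 < μ n)
    (hmono : ∀ m n : ℕ, 1 ≤ m → m ≤ n → μ n ≤ μ m)
    (h0 : Tendsto μ atTop (𝓝 0))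
    (hL : L ∈ Set.Ioo (0:ℝ) 1)
    (hlim : Tendsto (fun n : ℕ => μ (2 * n) / μ n) atTop (𝓝 L))
    (hs₁ : ∀ δ : ℝ, ¬ Summable (fun k : ℕ => μ k ^ δ) →
      ∀ n : ℕ, s δ n = ∑ k ∈ Finset.Icc 1 n, μ k ^ δ)
    (hs₂ : ∀ δ : ℝ, Summable (fun k : ℕ => μ k ^ δ) →
      ∀ n : ℕ, s δ n = ∑' k : ℕ, if n ≤ k then μ k ^ δ else 0) :
    MapClusterPt (1 : ℝ) atTop (fun n : ℕ => s d (2 * n) / s d n) ↔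
      d = Real.log 2 / Real.log (1 / L) := by

  obtain ⟨hL0, hL1⟩ := hL
  have hp : ∀ n, 1 ≤ n → 0 < μ n ^ d := fun n hn => Real.rpow_pos_of_pos (hpos n hn) d
  have hm : ∀ m n : ℕ, 1 ≤ m → m ≤ n → μ n ^ d ≤ μ m ^ d := fun m n h1 h2 =>
    Real.rpow_le_rpow (hpos n (by omega)).le (hmono m n h1 h2) hd.le
  have hq0 : 0 < L ^ d := Real.rpow_pos_of_pos hL0 d
  have hq : Tendsto (fun n : ℕ => μ (2 * n) ^ d / μ n ^ d) atTop (𝓝 (L ^ d)) := by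
    refine (hlim.rpow_const (Or.inl hL0.ne')).congr' ?_
    filter_upwards [eventually_ge_atTop 1] with n hn
    exact Real.div_rpow (hpos _ (by omega)).le (hpos _ hn).le d
  have hfin : 2 * L ^ d = 1 ↔ d = Real.log 2 / Real.log (1 / L) := by
    have hlog : Real.log L < 0 := Real.log_neg hL0 hL1
    have h2 : Real.log (2 * L ^ d) = Real.log 2 + d * Real.log L := by
      rw [Real.log_mul (by norm_num) hq0.ne', Real.log_rpow hL0]
    rw [one_div, Real.log_inv, eq_div_iff (by linarith)]
    constructor
    · intro h
      rw [h, Real.log_one] at h2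
      linarith
    · intro h
      exact Real.eq_one_of_pos_of_log_eq_zero (by linarith) (by linarith)
  rw [← hfin]
  by_cases hs : Summable (fun k : ℕ => μ k ^ d)
  · have e : ∀ n, s d n = EccAux.T (fun k : ℕ => μ k ^ d) n := fun n => by
      rw [hs₂ d hs n, ← EccAux.tsum_ite_eq_T hs n]
    simp only [e]
    exact EccAux.case_summable hp hm hq0 hq hs
  · have e : ∀ n, s d n = EccAux.S (fun k : ℕ => μ k ^ d) n := fun n => by
      rw [hs₁ d hs n, ← EccAux.sum_Icc_eq_S]
    simp only [e]
    exact EccAux.case_not_summable hp hm hq hs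
end
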